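/- arXiv:2310.07266 — 10 statements merged into one kernel-verified Lean document; each statement's English description precedes it below -/
import Mathlib

section
/- Let A : ℝ → ℝ be smooth and define the operator I on smooth functions H : ℝ → ℝ by (I H)(y) := H(y)·A(y) − H'(y), with iterations I^ℓ (I^0 H = H). Then for every ℓ ∈ ℕ and all smooth H₁, H₂ : ℝ → ℝ, the extraction formula holds: I^ℓ(H₁·H₂) = Σ_{j=0}^{ℓ} (−1)^j · binom(ℓ, j) · I^{ℓ−j}(H₁) · H₂^{(j)}, as an identity of functions on ℝ. -/
/-- The first-order operator `(I H)(y) = H(y)·A(y) - H'(y)`. -/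
noncomputable def weightOp (A : ℝ → ℝ) (H : ℝ → ℝ) : ℝ → ℝ :=
  fun y => H y * A y - deriv H y

/-- Iterations of `weightOp`, with `I^0 H = H`. -/
noncomputable def weightOpIter (A : ℝ → ℝ) : ℕ → (ℝ → ℝ) → (ℝ → ℝ)
  | 0 => fun H => H
  | (n + 1) => fun H => weightOp A (weightOpIter A n H)

theorem ContDiff.weightOpIter {A H : ℝ → ℝ} (hA : ContDiff ℝ (⊤ : ℕ∞) A)
    (hH : ContDiff ℝ (⊤ : ℕ∞) H) (n : ℕ) : ContDiff ℝ (⊤ : ℕ∞) (weightOpIter A n H) := by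
  induction n with
  | zero => exact hH
  | succ n ih => exact (ih.mul hA).sub (contDiff_infty_iff_deriv.1 ih).2

/-- the extraction formula
`I^ℓ(H₁ H₂) = Σ_{j=0}^ℓ (-1)^j binom(ℓ,j) I^{ℓ-j}(H₁) H₂^{(j)}`. -/
theorem stmt_3
    (A : ℝ → ℝ) (hA : ContDiff ℝ (⊤ : ℕ∞) A)
    (ℓ : ℕ) (H₁ H₂ : ℝ → ℝ) (hH₁ : ContDiff ℝ (⊤ : ℕ∞) H₁) (hH₂ : ContDiff ℝ (⊤ : ℕ∞) H₂) :
    weightOpIter A ℓ (fun y => H₁ y * H₂ y)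
      = fun y => ∑ j ∈ Finset.range (ℓ + 1),
          (-1 : ℝ) ^ j * (ℓ.choose j : ℝ) * weightOpIter A (ℓ - j) H₁ y
            * iteratedDeriv j H₂ y := by
  induction ℓ with
  | zero => simp [weightOpIter]
  | succ n ih =>
    ext y
    have hd (j : ℕ) : HasDerivAt
        (fun z => (-1 : ℝ) ^ j * (n.choose j : ℝ) * weightOpIter A (n - j) H₁ z
          * iteratedDeriv j H₂ z)
        ((-1 : ℝ) ^ j * (n.choose j : ℝ) * deriv (weightOpIter A (n - j) H₁) y
            * iteratedDeriv j H₂ y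
          + (-1 : ℝ) ^ j * (n.choose j : ℝ) * weightOpIter A (n - j) H₁ y
            * iteratedDeriv (j + 1) H₂ y) y := by
      have h₁ := ((hA.weightOpIter hH₁ (n - j)).differentiable (by simp) y).hasDerivAt
      have h₂ := (hH₂.differentiable_iteratedDeriv j
        (by exact_mod_cast WithTop.coe_lt_top j) y).hasDerivAt
      rw [← iteratedDeriv_succ] at h₂
      exact (h₁.const_mul _).mul h₂
    have hsum := HasDerivAt.fun_sum (u := Finset.range (n + 1)) fun j _ => hd j
    have pascal := Finset.sum_choose_succ_mul
      (fun i k => (-1 : ℝ) ^ i * weightOpIter A k H₁ y * iteratedDeriv i H₂ y) n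
    change weightOp A (weightOpIter A n _) y = _
    rw [ih, weightOp, hsum.deriv]
    trans ∑ i ∈ Finset.range (n + 2), ((n + 1).choose i : ℝ)
      * ((-1 : ℝ) ^ i * weightOpIter A (n + 1 - i) H₁ y * iteratedDeriv i H₂ y)
    · rw [pascal, Finset.sum_mul, ← Finset.sum_sub_distrib, ← Finset.sum_add_distrib]
      refine Finset.sum_congr rfl fun j hj => ?_
      have hstep : weightOpIter A (n - j + 1) H₁ y = weightOpIter A (n - j) H₁ y * A y
          - deriv (weightOpIter A (n - j) H₁) y := rfl
      rw [Nat.sub_add_comm (Finset.mem_range_succ_iff.1 hj), hstep]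
      ring
    · exact Finset.sum_congr rfl fun j _ => by ring
end

section
/- Let σ : ℝ → ℝ be smooth with σ(x) > 0 for all x, let L ∈ ℝ, t > 0 and ρ ∈ {0,1}, and set μ(x) := ρx + (1−ρ)(2L−x). For a smooth function h : ℝ² → ℝ define (I h)(x,y) := h(x,y)·(y−μ(x))/(σ(x)²·t) − ∂₂h(x,y), and define the flow derivative (D̂ h)(x,y) := ∂₁h(x,y) + ∂₂h(x,y)·[(2ρ−1) + σ'(x)·(y−μ(x))/σ(x)]. Then the chain-rule type formula holds: D̂(I h) = I(D̂ h) − (σ'(x)/σ(x))·(I h), as an identity of functions on ℝ². -/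
/-- Partial derivative in the first variable of a function of two real variables. -/
noncomputable def pderiv1 (h : ℝ → ℝ → ℝ) (x y : ℝ) : ℝ := deriv (fun u => h u y) x

/-- Partial derivative in the second variable of a function of two real variables. -/
noncomputable def pderiv2 (h : ℝ → ℝ → ℝ) (x y : ℝ) : ℝ := deriv (fun v => h x v) y

lemma hasDerivAt_uncurry_fst {h : ℝ → ℝ → ℝ} {x y : ℝ}
    (hh : DifferentiableAt ℝ (fun p : ℝ × ℝ => h p.1 p.2) (x, y)) :
    HasDerivAt (fun u => h u y) (fderiv ℝ (fun p : ℝ × ℝ => h p.1 p.2) (x, y) (1, 0)) x :=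
  hh.hasFDerivAt.comp_hasDerivAt (f := fun u : ℝ => (u, y)) x
    ((hasDerivAt_id x).prodMk (hasDerivAt_const x y))

lemma hasDerivAt_uncurry_snd {h : ℝ → ℝ → ℝ} {x y : ℝ}
    (hh : DifferentiableAt ℝ (fun p : ℝ × ℝ => h p.1 p.2) (x, y)) :
    HasDerivAt (fun v => h x v) (fderiv ℝ (fun p : ℝ × ℝ => h p.1 p.2) (x, y) (0, 1)) y :=
  hh.hasFDerivAt.comp_hasDerivAt (f := fun v : ℝ => (x, v)) y
    ((hasDerivAt_const y x).prodMk (hasDerivAt_id y))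

lemma hasDerivAt_pderiv1 {h : ℝ → ℝ → ℝ} (hh : Differentiable ℝ (fun p : ℝ × ℝ => h p.1 p.2))
    (x y : ℝ) : HasDerivAt (fun u => h u y) (pderiv1 h x y) x :=
  (hasDerivAt_uncurry_fst (hh (x, y))).differentiableAt.hasDerivAt

lemma hasDerivAt_pderiv2 {h : ℝ → ℝ → ℝ} (hh : Differentiable ℝ (fun p : ℝ × ℝ => h p.1 p.2))
    (x y : ℝ) : HasDerivAt (fun v => h x v) (pderiv2 h x y) y :=
  (hasDerivAt_uncurry_snd (hh (x, y))).differentiableAt.hasDerivAt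

lemma pderiv1_eq_fderiv {h : ℝ → ℝ → ℝ} (hh : Differentiable ℝ (fun p : ℝ × ℝ => h p.1 p.2)) :
    (fun p : ℝ × ℝ => pderiv1 h p.1 p.2) =
      fun p => fderiv ℝ (fun p : ℝ × ℝ => h p.1 p.2) p (1, 0) :=
  funext fun p => (hasDerivAt_uncurry_fst (hh (p.1, p.2))).deriv

lemma pderiv2_eq_fderiv {h : ℝ → ℝ → ℝ} (hh : Differentiable ℝ (fun p : ℝ × ℝ => h p.1 p.2)) :
    (fun p : ℝ × ℝ => pderiv2 h p.1 p.2) =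
      fun p => fderiv ℝ (fun p : ℝ × ℝ => h p.1 p.2) p (0, 1) :=
  funext fun p => (hasDerivAt_uncurry_snd (hh (p.1, p.2))).deriv

lemma differentiable_fderiv_of_contDiff_two {f : ℝ × ℝ → ℝ} (hf : ContDiff ℝ 2 f) :
    Differentiable ℝ (fderiv ℝ f) :=
  (hf.fderiv_right (m := 1) (by norm_num)).differentiable (by norm_num)

lemma differentiable_pderiv1 {h : ℝ → ℝ → ℝ} (hh : ContDiff ℝ 2 (fun p : ℝ × ℝ => h p.1 p.2)) :
    Differentiable ℝ (fun p : ℝ × ℝ => pderiv1 h p.1 p.2) := by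
  rw [pderiv1_eq_fderiv (hh.differentiable (by norm_num))]
  exact (differentiable_fderiv_of_contDiff_two hh).clm_apply (differentiable_const _)

lemma differentiable_pderiv2 {h : ℝ → ℝ → ℝ} (hh : ContDiff ℝ 2 (fun p : ℝ × ℝ => h p.1 p.2)) :
    Differentiable ℝ (fun p : ℝ × ℝ => pderiv2 h p.1 p.2) := by
  rw [pderiv2_eq_fderiv (hh.differentiable (by norm_num))]
  exact (differentiable_fderiv_of_contDiff_two hh).clm_apply (differentiable_const _)

/-- Symmetry of the mixed partial derivatives of a `C²` function. -/
lemma pderiv1_pderiv2_comm {h : ℝ → ℝ → ℝ} (hh : ContDiff ℝ 2 (fun p : ℝ × ℝ => h p.1 p.2))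
    (x y : ℝ) : pderiv1 (pderiv2 h) x y = pderiv2 (pderiv1 h) x y := by
  have hd := hh.differentiable (by norm_num)
  have hd' := differentiable_fderiv_of_contDiff_two hh (x, y)
  have hsymm : IsSymmSndFDerivAt ℝ (fun p : ℝ × ℝ => h p.1 p.2) (x, y) :=
    hh.contDiffAt.isSymmSndFDerivAt (by simp)
  have h12 := (hasDerivAt_uncurry_fst (differentiable_pderiv2 hh (x, y))).deriv
  have h21 := (hasDerivAt_uncurry_snd (differentiable_pderiv1 hh (x, y))).deriv
  rw [pderiv2_eq_fderiv hd, fderiv_clm_apply hd' (differentiableAt_const _)] at h12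
  rw [pderiv1_eq_fderiv hd, fderiv_clm_apply hd' (differentiableAt_const _)] at h21
  refine h12.trans (Eq.trans ?_ h21.symm)
  simpa using hsymm (1, 0) (0, 1)

/-- chain rule for the simplified Malliavin integral operator of the
reflected Markov chain step: `D̂(I h) = I(D̂ h) - (σ'/σ)·(I h)`. -/
theorem stmt_5
    (σ : ℝ → ℝ) (hσ : ContDiff ℝ (⊤ : ℕ∞) σ) (hσpos : ∀ x, 0 < σ x)
    (L t : ℝ) (ht : 0 < t) (ρ : ℝ) (hρ : ρ = 0 ∨ ρ = 1)
    (μ : ℝ → ℝ) (hμ : ∀ x, μ x = ρ * x + (1 - ρ) * (2 * L - x))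
    (I : (ℝ → ℝ → ℝ) → ℝ → ℝ → ℝ)
    (hI : ∀ h x y, I h x y = h x y * (y - μ x) / (σ x ^ 2 * t) - pderiv2 h x y)
    (DF : (ℝ → ℝ → ℝ) → ℝ → ℝ → ℝ)
    (hDF : ∀ h x y, DF h x y = pderiv1 h x y
        + pderiv2 h x y * ((2 * ρ - 1) + deriv σ x * (y - μ x) / σ x))
    (h : ℝ → ℝ → ℝ) (hh : ContDiff ℝ (⊤ : ℕ∞) (fun p : ℝ × ℝ => h p.1 p.2)) :
    ∀ x y, DF (I h) x y = I (DF h) x y - deriv σ x / σ x * I h x y := by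
  intro x y
  have hσx : σ x ≠ 0 := (hσpos x).ne'
  have ht0 : t ≠ 0 := ht.ne'
  have hh2 : ContDiff ℝ 2 (fun p : ℝ × ℝ => h p.1 p.2) := hh.of_le (WithTop.coe_le_coe.2 le_top)
  have hd := hh2.differentiable (by norm_num)
  have hσ' : HasDerivAt σ (deriv σ x) x := ((hσ.differentiable (by simp)) x).hasDerivAt
  have hμ' : HasDerivAt μ (2 * ρ - 1) x := by
    rw [funext hμ]
    refine (((hasDerivAt_id x).const_mul ρ).add
      (((hasDerivAt_id x).const_sub (2 * L)).const_mul (1 - ρ))).congr_deriv ?_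
    ring
  have hI1 : pderiv1 (I h) x y =
      deriv (fun u => h u y * (y - μ u) / (σ u ^ 2 * t) - pderiv2 h u y) x := by
    simp only [pderiv1, hI]
  have hI2 : pderiv2 (I h) x y =
      deriv (fun v => h x v * (v - μ x) / (σ x ^ 2 * t) - pderiv2 h x v) y :=
    congrArg (deriv · y) (funext (hI h x))
  have hD2 : pderiv2 (DF h) x y = deriv (fun v => pderiv1 h x v
      + pderiv2 h x v * ((2 * ρ - 1) + deriv σ x * (v - μ x) / σ x)) y :=
    congrArg (deriv · y) (funext (hDF h x))
  replace hI1 := hI1.trans ((((hasDerivAt_pderiv1 hd x y).mul (hμ'.const_sub y)).div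
    ((hσ'.pow 2).mul_const t) (mul_ne_zero (pow_ne_zero 2 hσx) ht0)).sub
    (hasDerivAt_pderiv1 (differentiable_pderiv2 hh2) x y)).deriv
  replace hI2 := hI2.trans ((((hasDerivAt_pderiv2 hd x y).mul
    ((hasDerivAt_id y).sub_const (μ x))).div_const (σ x ^ 2 * t)).sub
    (hasDerivAt_pderiv2 (differentiable_pderiv2 hh2) x y)).deriv
  replace hD2 := hD2.trans ((hasDerivAt_pderiv2 (differentiable_pderiv1 hh2) x y).add
    ((hasDerivAt_pderiv2 (differentiable_pderiv2 hh2) x y).mul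
      (((((hasDerivAt_id y).sub_const (μ x)).const_mul (deriv σ x)).div_const
        (σ x)).const_add (2 * ρ - 1)))).deriv
  rw [hDF, hI (DF h), hI1, hI2, hD2, hDF h, hI h, pderiv1_pderiv2_comm hh2]
  simp only [id, Pi.pow_apply, Pi.mul_apply]
  field_simp
  ring
end

section
/- For every λ > 0 and every y ∈ ℝ, ∫₀^∞ λ e^{−λs} · (2πs)^{-1/2} e^{−y²/(2s)} ds = (√(2λ)/2) · e^{−√(2λ)·|y|}. In particular, if T₁ is exponentially distributed with rate λ and, conditionally on T₁ = s, X is a centered Gaussian with variance s, then X has the symmetric (Laplace) exponential density y ↦ (√(2λ)/2) e^{−√(2λ)|y|}. -/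
open Real MeasureTheory

/-- The change of variables `t = a * u - b / u` from `(0, ∞)` onto `ℝ`. -/
lemma image_mul_sub_div_Ioi {a b : ℝ} (ha : 0 < a) (hb : 0 < b) :
    (fun u : ℝ => a * u - b / u) '' Set.Ioi 0 = Set.univ := by
  refine Set.eq_univ_of_forall fun t => ?_
  have hab : 0 < a * b := mul_pos ha hb
  have hsq : √(t ^ 2 + 4 * (a * b)) ^ 2 = t ^ 2 + 4 * (a * b) := Real.sq_sqrt (by positivity)
  have hpos : 0 < t + √(t ^ 2 + 4 * (a * b)) := by
    have h : |t| < √(t ^ 2 + 4 * (a * b)) := by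
      rw [← Real.sqrt_sq_eq_abs]
      exact Real.sqrt_lt_sqrt (sq_nonneg t) (by linarith)
    linarith [neg_abs_le t]
  refine ⟨(t + √(t ^ 2 + 4 * (a * b))) / (2 * a), div_pos hpos (by positivity), ?_⟩
  generalize √(t ^ 2 + 4 * (a * b)) = r at hsq hpos ⊢
  have hne := hpos.ne'
  simp only
  field_simp
  linear_combination hsq

lemma injOn_mul_sub_div_Ioi {a b : ℝ} (ha : 0 < a) (hb : 0 < b) :
    Set.InjOn (fun u : ℝ => a * u - b / u) (Set.Ioi 0) := by
  refine StrictMonoOn.injOn fun u hu v _ huv => ?_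
  have h1 : a * u < a * v := by gcongr
  have h2 : b / v < b / u := div_lt_div_of_pos_left hb hu huv
  linarith

lemma hasDerivAt_const_div (b : ℝ) {u : ℝ} (hu : u ≠ 0) :
    HasDerivAt (fun u : ℝ => b / u) (-(b / u ^ 2)) u := by
  simpa [div_eq_mul_inv] using (hasDerivAt_inv hu).const_mul b

lemma image_const_div_Ioi {c : ℝ} (hc : 0 < c) :
    (fun u : ℝ => c / u) '' Set.Ioi 0 = Set.Ioi 0 := by
  ext t
  constructor
  · rintro ⟨u, hu, rfl⟩
    exact div_pos hc hu
  · intro ht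
    exact ⟨c / t, div_pos hc ht, div_div_cancel₀ hc.ne'⟩

lemma injOn_const_div_Ioi {c : ℝ} (hc : 0 < c) :
    Set.InjOn (fun u : ℝ => c / u) (Set.Ioi 0) := by
  refine StrictAntiOn.injOn fun u hu v _ huv => ?_
  exact div_lt_div_of_pos_left hc hu huv

lemma integrableOn_exp_neg_mul_sub_div_sq {a : ℝ} (b : ℝ) (ha : 0 < a) :
    IntegrableOn (fun u : ℝ => exp (-(a * u - b / u) ^ 2)) (Set.Ioi 0) := by
  have hg : IntegrableOn (fun u : ℝ => exp (2 * (a * b)) * exp (-a ^ 2 * u ^ 2)) (Set.Ioi 0) :=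
    ((integrable_exp_neg_mul_sq (by positivity)).const_mul _).integrableOn
  refine hg.mono' (by fun_prop) ?_
  filter_upwards [ae_restrict_mem measurableSet_Ioi] with u (hu : 0 < u)
  rw [Real.norm_eq_abs, abs_exp, ← exp_add, exp_le_exp]
  have h : (a * u - b / u) ^ 2 = a ^ 2 * u ^ 2 - 2 * (a * b) + (b / u) ^ 2 := by
    field_simp
    ring
  linarith [sq_nonneg (b / u)]

/-- The Cauchy–Schlömilch substitution applied to the Gaussian integral. -/
theorem integral_exp_neg_mul_sub_div_sq {a b : ℝ} (ha : 0 < a) (hb : 0 ≤ b) :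
    ∫ u in Set.Ioi (0 : ℝ), exp (-(a * u - b / u) ^ 2) = √π / (2 * a) := by
  rcases hb.eq_or_lt with rfl | hb
  · have h := integral_gaussian_Ioi (a ^ 2)
    rw [Real.sqrt_div pi_pos.le, Real.sqrt_sq ha.le] at h
    simp only [zero_div, sub_zero, mul_pow, ← neg_mul]
    rw [h]
    ring
  have hc : 0 < b / a := div_pos hb ha
  have hd₁ : ∀ u ∈ Set.Ioi (0 : ℝ),
      HasDerivWithinAt (fun u : ℝ => a * u - b / u) (a + b / u ^ 2) (Set.Ioi 0) u := by
    intro u hu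
    have h := ((hasDerivAt_id' u).const_mul a).fun_sub (hasDerivAt_const_div b (ne_of_gt hu))
    simpa only [mul_one, sub_neg_eq_add] using h.hasDerivWithinAt
  have hd₂ : ∀ u ∈ Set.Ioi (0 : ℝ),
      HasDerivWithinAt (fun u : ℝ => b / a / u) (-(b / a / u ^ 2)) (Set.Ioi 0) u := fun u hu =>
    (hasDerivAt_const_div (b / a) (ne_of_gt hu)).hasDerivWithinAt
  have hreflect : ∀ u ∈ Set.Ioi (0 : ℝ),
      |-(b / a / u ^ 2)| • exp (-(a * (b / a / u) - b / (b / a / u)) ^ 2) =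
        b / a / u ^ 2 * exp (-(a * u - b / u) ^ 2) := by
    intro u (hu : 0 < u)
    rw [abs_neg, abs_of_pos (by positivity), smul_eq_mul,
      show a * (b / a / u) - b / (b / a / u) = -(a * u - b / u) by field_simp; ring, neg_sq]
  have hint := integrableOn_exp_neg_mul_sub_div_sq b ha
  have hint' : IntegrableOn (fun u : ℝ => b / a / u ^ 2 * exp (-(a * u - b / u) ^ 2))
      (Set.Ioi 0) := by
    have h := integrableOn_image_iff_integrableOn_abs_deriv_smul measurableSet_Ioi hd₂
      (injOn_const_div_Ioi hc) (fun u : ℝ => exp (-(a * u - b / u) ^ 2))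
    rw [image_const_div_Ioi hc] at h
    exact (integrableOn_congr_fun hreflect measurableSet_Ioi).1 (h.1 hint)
  have hsymm : ∫ u in Set.Ioi (0 : ℝ), exp (-(a * u - b / u) ^ 2) =
      ∫ u in Set.Ioi (0 : ℝ), b / a / u ^ 2 * exp (-(a * u - b / u) ^ 2) := by
    have h := integral_image_eq_integral_abs_deriv_smul measurableSet_Ioi hd₂
      (injOn_const_div_Ioi hc) (fun u : ℝ => exp (-(a * u - b / u) ^ 2))
    rw [image_const_div_Ioi hc] at h
    exact h.trans (setIntegral_congr_fun measurableSet_Ioi hreflect)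
  have hgauss : √π = ∫ u in Set.Ioi (0 : ℝ),
      (a * exp (-(a * u - b / u) ^ 2) +
        a * (b / a / u ^ 2 * exp (-(a * u - b / u) ^ 2))) := by
    have h := integral_image_eq_integral_abs_deriv_smul measurableSet_Ioi hd₁
      (injOn_mul_sub_div_Ioi ha hb) (fun t : ℝ => exp (-t ^ 2))
    have hg : ∫ t : ℝ, exp (-t ^ 2) = √π := by simpa using integral_gaussian 1
    rw [image_mul_sub_div_Ioi ha hb, setIntegral_univ, hg] at h
    refine h.trans (setIntegral_congr_fun measurableSet_Ioi fun u (hu : 0 < u) => ?_)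
    rw [abs_of_pos (by positivity), smul_eq_mul]
    field_simp
  rw [integral_add (hint.const_mul a) (hint'.const_mul a), integral_const_mul,
    integral_const_mul, ← hsymm] at hgauss
  rw [hgauss]
  field_simp
  ring

/-- the exponential mixture of centered Gaussian densities is the
symmetric (Laplace) exponential density with parameter `1/√(2λ)`. -/
theorem stmt_6 (lam : ℝ) (hlam : 0 < lam) (y : ℝ) :
    ∫ s in Set.Ioi (0 : ℝ),
        lam * Real.exp (-lam * s) * (Real.sqrt (2 * Real.pi * s))⁻¹ *
          Real.exp (-y ^ 2 / (2 * s))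
      = Real.sqrt (2 * lam) / 2 * Real.exp (-Real.sqrt (2 * lam) * |y|) := by
  have h2 : √2 ^ 2 = 2 := Real.sq_sqrt (by norm_num)
  have hl : √lam ^ 2 = lam := Real.sq_sqrt hlam.le
  have hlpos : 0 < √lam := Real.sqrt_pos.2 hlam
  have hπpos : 0 < √π := Real.sqrt_pos.2 pi_pos
  rw [← integral_comp_rpow_Ioi_of_pos (two_pos : (0 : ℝ) < 2), Real.sqrt_mul zero_le_two]
  have key : ∀ u ∈ Set.Ioi (0 : ℝ),
      (2 * u ^ ((2 : ℝ) - 1)) • (lam * exp (-lam * u ^ (2 : ℝ)) *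
        (√(2 * π * u ^ (2 : ℝ)))⁻¹ * exp (-y ^ 2 / (2 * u ^ (2 : ℝ)))) =
      2 * lam / (√2 * √π) * exp (-(√2 * √lam) * |y|) *
        exp (-(√lam * u - |y| / √2 / u) ^ 2) := by
    intro u (hu : 0 < u)
    have he : exp (-lam * u ^ 2) * exp (-y ^ 2 / (2 * u ^ 2)) =
        exp (-(√2 * √lam) * |y|) * exp (-(√lam * u - |y| / √2 / u) ^ 2) := by
      rw [← exp_add, ← exp_add]
      congr 1
      have hsq : (√lam * u - |y| / √2 / u) ^ 2 =
          √lam ^ 2 * u ^ 2 - 2 / √2 * √lam * |y| + |y| ^ 2 / √2 ^ 2 / u ^ 2 := by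
        field_simp
        ring
      rw [hsq, hl, h2, sq_abs, Real.div_sqrt]
      field_simp
      ring
    rw [show (2 : ℝ) - 1 = 1 by norm_num, Real.rpow_one, Real.rpow_two,
      Real.sqrt_mul (by positivity), Real.sqrt_mul zero_le_two, Real.sqrt_sq hu.le, smul_eq_mul]
    calc _ = 2 * lam / (√2 * √π) * (exp (-lam * u ^ 2) * exp (-y ^ 2 / (2 * u ^ 2))) := by
          field_simp
      _ = _ := by rw [he, mul_assoc]
  rw [setIntegral_congr_fun measurableSet_Ioi key, integral_const_mul,
    integral_exp_neg_mul_sub_div_sq hlpos (by positivity)]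
  field_simp
  rw [h2, hl]
end

section
/- For all a > 0 and b > 0, ∫₀^∞ s^{-1/2} · exp(−(a s + b/s)) ds = √(π/a) · e^{−2√(ab)}. -/
open Real MeasureTheory

lemma sqrt_sq_add_gt_abs {k : ℝ} (hk : 0 < k) (u : ℝ) : |u| < √(u ^ 2 + k) :=
  Real.lt_sqrt_of_sq_lt (by rw [sq_abs]; linarith)

lemma add_sqrt_sq_add_pos {k : ℝ} (hk : 0 < k) (u : ℝ) : 0 < u + √(u ^ 2 + k) := by
  linarith [sqrt_sq_add_gt_abs hk u, neg_abs_le u]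

lemma hasDerivAt_add_sqrt_sq_add {k : ℝ} (hk : 0 < k) (u : ℝ) :
    HasDerivAt (fun u : ℝ => u + √(u ^ 2 + k)) (1 + u / √(u ^ 2 + k)) u := by
  have h : HasDerivAt (fun u : ℝ => u ^ 2 + k) (2 * u) u := by
    simpa using (hasDerivAt_pow 2 u).add_const k
  convert! (hasDerivAt_id u).add (h.sqrt (by positivity)) using 1
  rw [mul_div_mul_left _ _ two_ne_zero]

lemma injective_add_sqrt_sq_add {k : ℝ} (hk : 0 < k) :
    Function.Injective (fun u : ℝ => u + √(u ^ 2 + k)) := by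
  refine (strictMono_of_hasDerivAt_pos (hasDerivAt_add_sqrt_sq_add hk) fun u => ?_).injective
  have hr : 0 < √(u ^ 2 + k) := by positivity
  rw [one_add_div hr.ne', add_comm]
  exact div_pos (add_sqrt_sq_add_pos hk u) hr

/-- The odd part `u / √(u ^ 2 + k)` of the weight does not contribute to a Gaussian integral. -/
lemma integral_one_add_div_sqrt_mul_gaussian {k : ℝ} (hk : 0 < k) :
    ∫ u : ℝ, (1 + u / √(u ^ 2 + k)) * rexp (-u ^ 2) = √π := by
  have hg : Integrable fun u : ℝ => rexp (-u ^ 2) := by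
    simpa using integrable_exp_neg_mul_sq one_pos
  have hodd : Integrable fun u : ℝ => u / √(u ^ 2 + k) * rexp (-u ^ 2) := by
    refine hg.bdd_mul (c := 1) (Measurable.aestronglyMeasurable (by fun_prop))
      (.of_forall fun u => ?_)
    rw [norm_div, Real.norm_eq_abs, Real.norm_of_nonneg (Real.sqrt_nonneg _)]
    exact div_le_one_of_le₀ (sqrt_sq_add_gt_abs hk u).le (Real.sqrt_nonneg _)
  have hzero : ∫ u : ℝ, u / √(u ^ 2 + k) * rexp (-u ^ 2) = 0 := by
    have h := integral_neg_eq_self (fun u : ℝ => u / √(u ^ 2 + k) * rexp (-u ^ 2)) volume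
    simp only [neg_sq, neg_div, neg_mul, integral_neg] at h
    linarith
  simp only [add_mul, one_mul]
  rw [integral_add hg hodd, hzero, add_zero]
  simpa using integral_gaussian 1

/-- the closed-form normalization integral underlying the
Generalized Inverse Gaussian distribution with index `p = 1/2`. -/
theorem stmt_7 (a b : ℝ) (ha : 0 < a) (hb : 0 < b) :
    ∫ s in Set.Ioi (0 : ℝ), (Real.sqrt s)⁻¹ * Real.exp (-(a * s + b / s))
      = Real.sqrt (Real.pi / a) * Real.exp (-2 * Real.sqrt (a * b)) := by
  set c := √(a * b) with hc_def
  have hc : 0 < c := by positivity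
  have hcc : c ^ 2 = a * b := Real.sq_sqrt (by positivity)
  have hk : 0 < 4 * c := by positivity
  let w : ℝ → ℝ := fun u => u + √(u ^ 2 + 4 * c)
  have hw : ∀ u, 0 < w u := add_sqrt_sq_add_pos hk
  let g : ℝ → ℝ := fun u => w u ^ 2 / (4 * a)
  have hinj : Function.Injective g := fun u v huv => by
    refine injective_add_sqrt_sq_add hk ((sq_eq_sq₀ (hw u).le (hw v).le).1 ?_)
    exact (div_left_inj' (by positivity)).1 huv
  have himage : g '' Set.univ = Set.Ioi 0 := by
    refine Set.Subset.antisymm ?_ fun s (hs : 0 < s) => ?_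
    · rintro _ ⟨u, -, rfl⟩
      have := hw u
      exact Set.mem_Ioi.2 (by positivity)
    · have hx : 0 < √(a * s) := by positivity
      refine ⟨√(a * s) - c / √(a * s), trivial, ?_⟩
      have hr : (√(a * s) - c / √(a * s)) ^ 2 + 4 * c = (√(a * s) + c / √(a * s)) ^ 2 := by
        field_simp
        ring
      have hwx : w (√(a * s) - c / √(a * s)) = 2 * √(a * s) := by
        simp only [w]
        rw [hr, Real.sqrt_sq (by positivity)]
        ring
      simp only [g]
      rw [hwx, mul_pow, Real.sq_sqrt (by positivity)]
      field_simp
      norm_num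
  have hderiv (u : ℝ) : HasDerivAt g (w u * (1 + u / √(u ^ 2 + 4 * c)) / (2 * a)) u := by
    convert! ((hasDerivAt_add_sqrt_sq_add hk u).pow 2).div_const (4 * a) using 1
    simp only [w]
    field_simp
    ring
  have hpt (u : ℝ) : |w u * (1 + u / √(u ^ 2 + 4 * c)) / (2 * a)| •
      ((√(g u))⁻¹ * rexp (-(a * g u + b / g u))) =
      rexp (-2 * c) / √a * ((1 + u / √(u ^ 2 + 4 * c)) * rexp (-u ^ 2)) := by
    have hwu := hw u
    have hr : 0 < √(u ^ 2 + 4 * c) := by positivity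
    have hr2 : √(u ^ 2 + 4 * c) ^ 2 = u ^ 2 + 4 * c := Real.sq_sqrt (by positivity)
    have hfac : 0 < 1 + u / √(u ^ 2 + 4 * c) := by
      rw [one_add_div hr.ne', add_comm]
      exact div_pos hwu hr
    have hconj : 2 * c / w u = (√(u ^ 2 + 4 * c) - u) / 2 := by
      rw [div_eq_div_iff hwu.ne' two_ne_zero]
      simp only [w]
      linear_combination -hr2
    have hexp : a * g u + b / g u = u ^ 2 + 2 * c := by
      have h : a * g u + b / g u = w u ^ 2 / 4 + (2 * c / w u) ^ 2 := by
        simp only [g]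
        field_simp
        rw [hcc]
        ring
      rw [h, hconj]
      simp only [w]
      linear_combination hr2 / 2
    have hsqrt : √(g u) = w u / (2 * √a) := by
      rw [Real.sqrt_eq_iff_mul_self_eq (by positivity) (by positivity)]
      simp only [g]
      rw [div_mul_div_comm, mul_mul_mul_comm, Real.mul_self_sqrt ha.le]
      ring
    rw [hexp, hsqrt, abs_of_pos (by positivity), neg_add, Real.exp_add, smul_eq_mul, neg_mul]
    have hsa : √a ^ 2 = a := Real.sq_sqrt ha.le
    have hsa0 : 0 < √a := by positivity
    generalize 1 + u / √(u ^ 2 + 4 * c) = f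
    nth_rewrite 1 [← hsa]
    field_simp
  rw [← himage, integral_image_eq_integral_abs_deriv_smul MeasurableSet.univ
    (fun u _ => (hderiv u).hasDerivWithinAt) hinj.injOn, setIntegral_univ]
  simp only [hpt]
  rw [integral_const_mul, integral_one_add_div_sqrt_mul_gaussian hk, Real.sqrt_div Real.pi_pos.le]
  ring
end

section
/- Let m > 0, a > 0, U > 0 and let p_{m,a}(s) := (m/√(2πas³)) exp(−m²/(2as)) for s > 0 be the Lévy density. Let f : [0,U] → ℝ be continuously differentiable with f(U) = 0, and let G : (0,U] → ℝ be continuously differentiable with G and G' bounded. Then ∫₀^U f'(s) G(s) p_{m,a}(s) ds = ∫₀^U f(s) · [ G(s)·(3/(2s) − m²/(2as²)) − G'(s) ] · p_{m,a}(s) ds, both integrals being absolutely convergent. -/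
open MeasureTheory

/-- The Lévy density with parameters `m` (distance) and `a` (diffusion coefficient). -/
noncomputable def levyDensity (m a s : ℝ) : ℝ :=
  m / Real.sqrt (2 * Real.pi * a * s ^ 3) * Real.exp (-m ^ 2 / (2 * a * s))

theorem levyDensity_nonneg {m : ℝ} (hm : 0 ≤ m) (a s : ℝ) : 0 ≤ levyDensity m a s := by
  unfold levyDensity
  positivity

/-- The Lévy density vanishes at `0⁺` at least as fast as the cube. -/
theorem exists_levyDensity_le_mul_pow_three {m a : ℝ} (hm : 0 < m) (ha : 0 < a) :
    ∃ K, 0 ≤ K ∧ ∀ s, 0 < s → levyDensity m a s ≤ K * s ^ 3 := by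
  refine ⟨Real.sqrt (Nat.factorial 9 * a ^ 8 / (2 * Real.pi * m ^ 16)), Real.sqrt_nonneg _,
    fun s hs => ?_⟩
  have hπ := Real.pi_pos
  refine le_of_sq_le_sq ?_ (by positivity)
  have hexp : Real.exp (-m ^ 2 / (2 * a * s)) ^ 2 ≤
      Nat.factorial 9 / (m ^ 2 / (a * s)) ^ 9 := by
    have h := Real.pow_div_factorial_le_exp (m ^ 2 / (a * s)) (by positivity) 9
    have hsq : Real.exp (-m ^ 2 / (2 * a * s)) ^ 2 = (Real.exp (m ^ 2 / (a * s)))⁻¹ := by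
      rw [← Real.exp_nat_mul, ← Real.exp_neg]
      congr 1
      push_cast
      field_simp
    rw [hsq]
    exact (inv_anti₀ (by positivity) h).trans_eq (inv_div _ _)
  calc levyDensity m a s ^ 2
      = m ^ 2 / (2 * Real.pi * a * s ^ 3) * Real.exp (-m ^ 2 / (2 * a * s)) ^ 2 := by
        rw [levyDensity, mul_pow, div_pow, Real.sq_sqrt (by positivity)]
    _ ≤ m ^ 2 / (2 * Real.pi * a * s ^ 3) * (Nat.factorial 9 / (m ^ 2 / (a * s)) ^ 9) := by
        gcongr
    _ = (Real.sqrt (Nat.factorial 9 * a ^ 8 / (2 * Real.pi * m ^ 16)) * s ^ 3) ^ 2 := by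
        rw [mul_pow, Real.sq_sqrt (by positivity)]
        field_simp

theorem hasDerivAt_levyDensity (m : ℝ) {a s : ℝ} (ha : 0 < a) (hs : 0 < s) :
    HasDerivAt (levyDensity m a)
      (-(3 / (2 * s) - m ^ 2 / (2 * a * s ^ 2)) * levyDensity m a s) s := by
  have hπ := Real.pi_pos
  have hpos : 0 < 2 * Real.pi * a * s ^ 3 := by positivity
  have hsqrt := ((hasDerivAt_pow 3 s).const_mul (2 * Real.pi * a)).sqrt hpos.ne'
  have hexp := (((hasDerivAt_id s).const_mul (2 * a)).fun_inv
    (by simp; exact ⟨ha.ne', hs.ne'⟩)).const_mul (-m ^ 2) |>.exp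
  have h := ((hsqrt.fun_inv (Real.sqrt_pos.2 hpos).ne').const_mul m).fun_mul hexp
  simp only [id_eq, ← div_eq_mul_inv] at h
  refine HasDerivAt.congr_deriv (f := levyDensity m a) h ?_
  have hr : Real.sqrt (2 * Real.pi * a * s ^ 3) ^ 2 = 2 * Real.pi * a * s ^ 3 :=
    Real.sq_sqrt hpos.le
  have hr0 := Real.sqrt_pos.2 hpos
  rw [hr, levyDensity]
  set r := Real.sqrt (2 * Real.pi * a * s ^ 3)
  set E := Real.exp (-m ^ 2 / (2 * a * s))
  field_simp
  push_cast
  ring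

/-- integration by parts with respect to the Lévy density on `(0,U]`,
with no boundary terms since `f(U) = 0` and the density vanishes at `0⁺`. -/
theorem stmt_10
    (m a U : ℝ) (hm : 0 < m) (ha : 0 < a) (hU : 0 < U)
    (f f' : ℝ → ℝ)
    (hf : ∀ s ∈ Set.Icc 0 U, HasDerivWithinAt f (f' s) (Set.Icc 0 U) s)
    (hf' : ContinuousOn f' (Set.Icc 0 U))
    (hfU : f U = 0)
    (G G' : ℝ → ℝ)
    (hG : ∀ s ∈ Set.Ioc 0 U, HasDerivWithinAt G (G' s) (Set.Ioc 0 U) s)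
    (hG' : ContinuousOn G' (Set.Ioc 0 U))
    (hGbdd : ∃ C, ∀ s ∈ Set.Ioc 0 U, |G s| ≤ C ∧ |G' s| ≤ C) :
    IntegrableOn (fun s => f' s * G s * levyDensity m a s) (Set.Ioc 0 U) ∧
    IntegrableOn (fun s => f s *
        (G s * (3 / (2 * s) - m ^ 2 / (2 * a * s ^ 2)) - G' s) * levyDensity m a s)
      (Set.Ioc 0 U) ∧
    ∫ s in Set.Ioc (0 : ℝ) U, f' s * G s * levyDensity m a s
      = ∫ s in Set.Ioc (0 : ℝ) U,
          f s * (G s * (3 / (2 * s) - m ^ 2 / (2 * a * s ^ 2)) - G' s) *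
            levyDensity m a s := by
  obtain ⟨C, hC⟩ := hGbdd
  obtain ⟨K, hK, hp⟩ := exists_levyDensity_le_mul_pow_three hm ha
  have hsub : Set.Ioc 0 U ⊆ Set.Icc 0 U := Set.Ioc_subset_Icc_self
  have hfc : ContinuousOn f (Set.Icc 0 U) := fun s hs => (hf s hs).continuousWithinAt
  have hGc : ContinuousOn G (Set.Ioc 0 U) := fun s hs => (hG s hs).continuousWithinAt
  have hpc : ContinuousOn (levyDensity m a) (Set.Ioc 0 U) := fun s hs =>
    (hasDerivAt_levyDensity m ha hs.1).continuousAt.continuousWithinAt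
  have hwc : ContinuousOn (fun s : ℝ => 3 / (2 * s) - m ^ 2 / (2 * a * s ^ 2))
      (Set.Ioc 0 U) := by
    refine (continuousOn_const.div (by fun_prop) fun s hs => ?_).sub
      (continuousOn_const.div (by fun_prop) fun s hs => ?_)
    · have := hs.1; positivity
    · have := hs.1; positivity
  obtain ⟨A, hA⟩ := isCompact_Icc.exists_bound_of_continuousOn hfc
  obtain ⟨B, hB⟩ := isCompact_Icc.exists_bound_of_continuousOn hf'
  have hU' : U ∈ Set.Ioc 0 U := ⟨hU, le_rfl⟩
  have hC0 : 0 ≤ C := (abs_nonneg _).trans (hC U hU').1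
  have hA0 : 0 ≤ A := (norm_nonneg _).trans (hA U (hsub hU'))
  have hB0 : 0 ≤ B := (norm_nonneg _).trans (hB U (hsub hU'))
  have hfin : volume (Set.Ioc (0 : ℝ) U) < ⊤ := by simp
  have hint₁ : IntegrableOn (fun s => f' s * G s * levyDensity m a s) (Set.Ioc 0 U) := by
    refine IntegrableOn.of_bound hfin
      ((((hf'.mono hsub).mul hGc).mul hpc).aestronglyMeasurable measurableSet_Ioc)
      (B * C * (K * U ^ 3)) ?_
    refine (ae_restrict_iff' measurableSet_Ioc).2 (.of_forall fun s hs => ?_)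
    have hs0 := hs.1
    have hsU := hs.2
    rw [norm_mul, norm_mul, Real.norm_of_nonneg (levyDensity_nonneg hm.le a s)]
    refine mul_le_mul (mul_le_mul (hB s (hsub hs)) (hC s hs).1 (norm_nonneg _) hB0)
      ((hp s hs0).trans (by gcongr)) (levyDensity_nonneg hm.le a s) (by positivity)
  have hint₂ : IntegrableOn (fun s => f s *
      (G s * (3 / (2 * s) - m ^ 2 / (2 * a * s ^ 2)) - G' s) * levyDensity m a s)
      (Set.Ioc 0 U) := by
    refine IntegrableOn.of_bound hfin
      ((((hfc.mono hsub).mul ((hGc.mul hwc).sub hG')).mul hpc).aestronglyMeasurable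
        measurableSet_Ioc)
      (A * (C * (3 / 2 * K * U ^ 2 + m ^ 2 / (2 * a) * K * U) + C * (K * U ^ 3))) ?_
    refine (ae_restrict_iff' measurableSet_Ioc).2 (.of_forall fun s hs => ?_)
    have hs0 := hs.1
    have hsU := hs.2
    have hw : |3 / (2 * s) - m ^ 2 / (2 * a * s ^ 2)| ≤
        3 / (2 * s) + m ^ 2 / (2 * a * s ^ 2) := by
      refine (abs_sub _ _).trans_eq ?_
      rw [abs_of_nonneg (by positivity), abs_of_nonneg (by positivity)]
    have hin : |G s * (3 / (2 * s) - m ^ 2 / (2 * a * s ^ 2)) - G' s| ≤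
        C * (3 / (2 * s) + m ^ 2 / (2 * a * s ^ 2)) + C := by
      refine (abs_sub _ _).trans (add_le_add ?_ (hC s hs).2)
      rw [abs_mul]
      exact mul_le_mul (hC s hs).1 hw (abs_nonneg _) hC0
    rw [norm_mul, norm_mul, Real.norm_of_nonneg (levyDensity_nonneg hm.le a s), mul_assoc]
    refine mul_le_mul (hA s (hsub hs)) ?_
      (mul_nonneg (norm_nonneg _) (levyDensity_nonneg hm.le a s)) hA0
    calc |G s * (3 / (2 * s) - m ^ 2 / (2 * a * s ^ 2)) - G' s| * levyDensity m a s
        ≤ (C * (3 / (2 * s) + m ^ 2 / (2 * a * s ^ 2)) + C) * (K * s ^ 3) :=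
          mul_le_mul hin (hp s hs0) (levyDensity_nonneg hm.le a s) (by positivity)
      _ = C * (3 / 2 * K * s ^ 2 + m ^ 2 / (2 * a) * K * s) + C * (K * s ^ 3) := by
          field_simp
      _ ≤ _ := by gcongr
  refine ⟨hint₁, hint₂, ?_⟩
  have hderiv : ∀ s ∈ Set.Ioo 0 U, HasDerivAt (fun t => f t * G t * levyDensity m a t)
      (f' s * G s * levyDensity m a s -
        f s * (G s * (3 / (2 * s) - m ^ 2 / (2 * a * s ^ 2)) - G' s) * levyDensity m a s) s := by
    intro s hs
    have h := (((hf s (Set.Ioo_subset_Icc_self hs)).hasDerivAt (Icc_mem_nhds hs.1 hs.2)).fun_mul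
      ((hG s (Set.Ioo_subset_Ioc_self hs)).hasDerivAt (Ioc_mem_nhds hs.1 hs.2))).fun_mul
      (hasDerivAt_levyDensity m ha hs.1)
    exact h.congr_deriv (by ring)
  have hcont : ContinuousOn (fun t => f t * G t * levyDensity m a t) (Set.Ioc 0 U) :=
    ((hfc.mono hsub).mul hGc).mul hpc
  have hzero : Filter.Tendsto (fun t => f t * G t * levyDensity m a t)
      (nhdsWithin 0 (Set.Ioi 0)) (nhds 0) := by
    have hlim : Filter.Tendsto (fun t : ℝ => A * C * (K * t ^ 3))
        (nhdsWithin 0 (Set.Ioi 0)) (nhds 0) := by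
      have h : Continuous fun t : ℝ => A * C * (K * t ^ 3) := by fun_prop
      simpa using (h.tendsto 0).mono_left nhdsWithin_le_nhds
    refine squeeze_zero_norm' ?_ hlim
    filter_upwards [Ioc_mem_nhdsGT hU] with s hs
    rw [norm_mul, norm_mul, Real.norm_of_nonneg (levyDensity_nonneg hm.le a s)]
    exact mul_le_mul (mul_le_mul (hA s (hsub hs)) (hC s hs).1 (norm_nonneg _) hA0)
      (hp s hs.1) (levyDensity_nonneg hm.le a s) (by positivity)
  have hend : Filter.Tendsto (fun t => f t * G t * levyDensity m a t)
      (nhdsWithin U (Set.Iio U)) (nhds 0) := by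
    have h := (hcont U hU').tendsto.mono_left
      (nhdsWithin_le_of_mem (Filter.mem_of_superset (Ioo_mem_nhdsLT hU) Set.Ioo_subset_Ioc_self))
    simpa [hfU] using h
  have hftc := intervalIntegral.integral_eq_sub_of_hasDerivAt_of_tendsto hU hderiv
    ((intervalIntegrable_iff_integrableOn_Ioc_of_le hU.le).2 (hint₁.sub hint₂)) hzero hend
  rw [intervalIntegral.integral_of_le hU.le, integral_sub hint₁ hint₂, sub_zero] at hftc
  exact sub_eq_zero.1 hftc
end

section
/- For every k ∈ ℕ and λ > 0 there exists a constant C = C(k,λ) > 0 such that for all μ > 0, ∫₀^∞ s^{−k} · √(λ/(πs)) · exp(2λμ − λs − λμ²/s) ds ≤ C · (1 + μ^{1−2k}). (Inverse moment bound for the Generalized Inverse Gaussian distribution GIG(2λ, 2λμ², 1/2).) -/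
open MeasureTheory

/-- The map `s ↦ √s - μ / √s`, an increasing bijection from `(0, ∞)` onto `ℝ`. -/
noncomputable def sqrtSubDivSqrt (mu s : ℝ) : ℝ := √s - mu / √s

/-- The derivative of `sqrtSubDivSqrt` on `(0, ∞)`. -/
noncomputable def sqrtSubDivSqrtDeriv (mu s : ℝ) : ℝ := 1 / (2 * √s) + mu / (2 * (s * √s))

lemma hasDerivAt_sqrtSubDivSqrt (mu : ℝ) {s : ℝ} (hs : 0 < s) :
    HasDerivAt (sqrtSubDivSqrt mu) (sqrtSubDivSqrtDeriv mu s) s := by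
  have h1 := Real.hasDerivAt_sqrt hs.ne'
  have hx : √s ≠ 0 := (Real.sqrt_pos.2 hs).ne'
  have h2 := h1.sub ((hasDerivAt_const s mu).div h1 hx)
  refine h2.congr_deriv ?_
  unfold sqrtSubDivSqrtDeriv
  rw [Real.sq_sqrt hs.le]
  field_simp
  ring

lemma sqrtSubDivSqrtDeriv_pos {mu s : ℝ} (hmu : 0 < mu) (hs : 0 < s) :
    0 < sqrtSubDivSqrtDeriv mu s := by
  have := Real.sqrt_pos.2 hs
  unfold sqrtSubDivSqrtDeriv
  positivity

lemma injOn_sqrtSubDivSqrt {mu : ℝ} (hmu : 0 < mu) :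
    Set.InjOn (sqrtSubDivSqrt mu) (Set.Ioi 0) := by
  refine StrictMonoOn.injOn fun s hs t ht hst => ?_
  have hs' : 0 < √s := Real.sqrt_pos.2 hs
  have h : √s < √t := Real.sqrt_lt_sqrt (le_of_lt hs) hst
  have h2 : mu / √t < mu / √s := div_lt_div_of_pos_left hmu hs' h
  unfold sqrtSubDivSqrt
  linarith

lemma image_sqrtSubDivSqrt {mu : ℝ} (hmu : 0 < mu) :
    sqrtSubDivSqrt mu '' Set.Ioi 0 = Set.univ := by
  refine Set.eq_univ_of_forall fun y => ?_
  have hr : √(y ^ 2 + 4 * mu) ^ 2 = y ^ 2 + 4 * mu := Real.sq_sqrt (by positivity)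
  have hlt : |y| < √(y ^ 2 + 4 * mu) := by
    rw [← Real.sqrt_sq_eq_abs]
    exact Real.sqrt_lt_sqrt (sq_nonneg y) (by linarith)
  set r := √(y ^ 2 + 4 * mu)
  have hx : 0 < (y + r) / 2 := by linarith [neg_abs_le y]
  refine ⟨((y + r) / 2) ^ 2, by simpa using pow_pos hx 2, ?_⟩
  unfold sqrtSubDivSqrt
  rw [Real.sqrt_sq hx.le, sub_eq_iff_eq_add, ← sub_eq_iff_eq_add', eq_div_iff hx.ne']
  nlinarith

lemma integral_sqrtSubDivSqrtDeriv_mul {mu : ℝ} (hmu : 0 < mu) (g : ℝ → ℝ) :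
    ∫ s in Set.Ioi (0 : ℝ), sqrtSubDivSqrtDeriv mu s * g (sqrtSubDivSqrt mu s) = ∫ y, g y := by
  have h := integral_image_eq_integral_abs_deriv_smul measurableSet_Ioi
    (fun s hs => (hasDerivAt_sqrtSubDivSqrt mu hs).hasDerivWithinAt)
    (injOn_sqrtSubDivSqrt hmu) g
  rw [image_sqrtSubDivSqrt hmu, setIntegral_univ] at h
  rw [h]
  refine setIntegral_congr_fun measurableSet_Ioi fun s hs => ?_
  simp only [smul_eq_mul, abs_of_pos (sqrtSubDivSqrtDeriv_pos hmu hs)]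

lemma integrableOn_sqrtSubDivSqrtDeriv_mul {mu : ℝ} (hmu : 0 < mu) {g : ℝ → ℝ}
    (hg : Integrable g) :
    IntegrableOn (fun s => sqrtSubDivSqrtDeriv mu s * g (sqrtSubDivSqrt mu s)) (Set.Ioi 0) := by
  have h := integrableOn_image_iff_integrableOn_abs_deriv_smul measurableSet_Ioi
    (fun s hs => (hasDerivAt_sqrtSubDivSqrt mu hs).hasDerivWithinAt)
    (injOn_sqrtSubDivSqrt hmu) g
  rw [image_sqrtSubDivSqrt hmu, integrableOn_univ] at h
  refine (h.1 hg).congr_fun (fun s hs => ?_) measurableSet_Ioi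
  simp only [smul_eq_mul, abs_of_pos (sqrtSubDivSqrtDeriv_pos hmu hs)]

lemma sqrtSubDivSqrt_sq (mu : ℝ) {s : ℝ} (hs : 0 < s) :
    sqrtSubDivSqrt mu s ^ 2 = s + mu ^ 2 / s - 2 * mu := by
  have hx : √s ≠ 0 := (Real.sqrt_pos.2 hs).ne'
  unfold sqrtSubDivSqrt
  rw [sub_sq, div_pow, Real.sq_sqrt hs.le]
  field_simp
  ring

lemma inv_pow_mul_exp_le (j : ℕ) {lam mu s : ℝ} (hlam : 0 < lam) (hmu : 0 < mu) (hs : 0 < s) :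
    (s⁻¹) ^ j * Real.exp (-lam * sqrtSubDivSqrt mu s ^ 2) ≤
      (j.factorial * (2 / lam) ^ j * Real.exp lam) * ((1 + mu) / mu ^ 2) ^ j *
        Real.exp (-(lam / 2) * sqrtSubDivSqrt mu s ^ 2) := by
  have hsq := sqrtSubDivSqrt_sq mu hs
  set v := sqrtSubDivSqrt mu s
  have h1 : s⁻¹ ≤ (1 + mu) / mu ^ 2 * (v ^ 2 + 2) := by
    have h : mu ^ 2 / s ≤ (1 + mu) * (v ^ 2 + 2) := by nlinarith [mul_nonneg hmu.le (sq_nonneg v)]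
    rw [div_mul_eq_mul_div, le_div_iff₀ (by positivity)]
    calc s⁻¹ * mu ^ 2 = mu ^ 2 / s := by ring
      _ ≤ _ := h
  have h2 : (v ^ 2 + 2) ^ j ≤
      j.factorial * (2 / lam) ^ j * Real.exp (lam / 2 * (v ^ 2 + 2)) := by
    have h := Real.pow_div_factorial_le_exp (lam / 2 * (v ^ 2 + 2)) (by positivity) j
    rw [div_le_iff₀ (by positivity)] at h
    calc (v ^ 2 + 2) ^ j = (2 / lam) ^ j * (lam / 2 * (v ^ 2 + 2)) ^ j := by
          rw [← mul_pow]; congr 1; field_simp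
      _ ≤ (2 / lam) ^ j * (Real.exp (lam / 2 * (v ^ 2 + 2)) * j.factorial) := by gcongr
      _ = _ := by ring
  calc (s⁻¹) ^ j * Real.exp (-lam * v ^ 2)
      ≤ ((1 + mu) / mu ^ 2 * (v ^ 2 + 2)) ^ j * Real.exp (-lam * v ^ 2) := by gcongr
    _ = ((1 + mu) / mu ^ 2) ^ j * (v ^ 2 + 2) ^ j * Real.exp (-lam * v ^ 2) := by rw [mul_pow]
    _ ≤ ((1 + mu) / mu ^ 2) ^ j *
        (j.factorial * (2 / lam) ^ j * Real.exp (lam / 2 * (v ^ 2 + 2))) *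
          Real.exp (-lam * v ^ 2) := by gcongr
    _ = (j.factorial * (2 / lam) ^ j) * ((1 + mu) / mu ^ 2) ^ j *
        (Real.exp (lam / 2 * (v ^ 2 + 2)) * Real.exp (-lam * v ^ 2)) := by ring
    _ = (j.factorial * (2 / lam) ^ j) * ((1 + mu) / mu ^ 2) ^ j *
        (Real.exp lam * Real.exp (-(lam / 2) * v ^ 2)) := by
          rw [← Real.exp_add, ← Real.exp_add]; congr 2; ring
    _ = _ := by ring

lemma inv_sqrt_le_sqrtSubDivSqrtDeriv {mu s : ℝ} (hmu : 0 < mu) (hs : 0 < s) :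
    1 / √s ≤ 2 * sqrtSubDivSqrtDeriv mu s := by
  have hx := Real.sqrt_pos.2 hs
  have h : 2 * sqrtSubDivSqrtDeriv mu s = 1 / √s + mu / (s * √s) := by
    unfold sqrtSubDivSqrtDeriv; field_simp
  have : 0 < mu / (s * √s) := by positivity
  linarith

lemma inv_mul_inv_sqrt_le_sqrtSubDivSqrtDeriv {mu s : ℝ} (hmu : 0 < mu) (hs : 0 < s) :
    s⁻¹ * (1 / √s) ≤ 2 / mu * sqrtSubDivSqrtDeriv mu s := by
  have hx := Real.sqrt_pos.2 hs
  have h : 2 / mu * sqrtSubDivSqrtDeriv mu s = 1 / (mu * √s) + s⁻¹ * (1 / √s) := by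
    unfold sqrtSubDivSqrtDeriv; field_simp
  have : 0 < 1 / (mu * √s) := by positivity
  linarith

/-- If the integrand is dominated by a multiple of a Gaussian in `√s - μ / √s`, then its integral
is at most the corresponding multiple of the Gaussian integral. -/
lemma setIntegral_le_of_le_gaussian {b mu A : ℝ} (hb : 0 < b) (hmu : 0 < mu) {f : ℝ → ℝ}
    (hf0 : ∀ s > 0, 0 ≤ f s)
    (hf : ∀ s > 0, f s ≤
      A * (sqrtSubDivSqrtDeriv mu s * Real.exp (-b * sqrtSubDivSqrt mu s ^ 2))) :
    ∫ s in Set.Ioi (0 : ℝ), f s ≤ A * √(Real.pi / b) := by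
  rw [← integral_gaussian b,
    ← integral_sqrtSubDivSqrtDeriv_mul hmu fun y => Real.exp (-b * y ^ 2), ← integral_const_mul]
  refine integral_mono_of_nonneg ?_ ?_ ?_
  · exact (ae_restrict_iff' measurableSet_Ioi).2 (.of_forall hf0)
  · exact (integrableOn_sqrtSubDivSqrtDeriv_mul hmu (integrable_exp_neg_mul_sq hb)).const_mul A
  · exact (ae_restrict_iff' measurableSet_Ioi).2 (.of_forall hf)

lemma sqrt_mul_exp_eq (lam mu : ℝ) {s : ℝ} (hs : 0 < s) :
    √(lam / (Real.pi * s)) * Real.exp (2 * lam * mu - lam * s - lam * mu ^ 2 / s) =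
      √(lam / Real.pi) * (1 / √s) * Real.exp (-lam * sqrtSubDivSqrt mu s ^ 2) := by
  rw [sqrtSubDivSqrt_sq mu hs, ← div_div, Real.sqrt_div' _ hs.le]
  ring_nf

lemma inv_mul_div_sq_pow_le (j : ℕ) {mu : ℝ} (hmu : 0 < mu) :
    mu⁻¹ * ((1 + mu) / mu ^ 2) ^ j ≤ 2 ^ j * (1 + mu ^ ((1 : ℤ) - 2 * (j + 1 : ℕ))) := by
  have hz : mu ^ ((1 : ℤ) - 2 * (j + 1 : ℕ)) = mu⁻¹ * ((mu ^ 2) ^ j)⁻¹ := by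
    have : (1 : ℤ) - 2 * (j + 1 : ℕ) = -((1 + 2 * j : ℕ) : ℤ) := by push_cast; ring
    rw [this, zpow_neg, zpow_natCast, pow_add, pow_mul, pow_one, mul_inv]
  rw [hz]
  rcases le_total mu 1 with h | h
  · calc mu⁻¹ * ((1 + mu) / mu ^ 2) ^ j ≤ mu⁻¹ * (2 / mu ^ 2) ^ j := by gcongr; linarith
      _ = 2 ^ j * (mu⁻¹ * ((mu ^ 2) ^ j)⁻¹) := by rw [div_pow]; ring
      _ ≤ _ := by gcongr; linarith
  · have h1 : (1 + mu) / mu ^ 2 ≤ 2 := by rw [div_le_iff₀ (by positivity)]; nlinarith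
    calc mu⁻¹ * ((1 + mu) / mu ^ 2) ^ j ≤ 1 * 2 ^ j := by gcongr; exact inv_le_one_of_one_le₀ h
      _ = 2 ^ j * 1 := by ring
      _ ≤ _ := by gcongr; linarith [show 0 < mu⁻¹ * ((mu ^ 2) ^ j)⁻¹ by positivity]

/-- inverse moment bound for the Generalized Inverse Gaussian
distribution GIG(2λ, 2λμ², 1/2). -/
theorem stmt_13 (k : ℕ) (lam : ℝ) (hlam : 0 < lam) :
    ∃ C > 0, ∀ mu : ℝ, 0 < mu →
      ∫ s in Set.Ioi (0 : ℝ),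
          s ^ (-(k : ℤ)) * (Real.sqrt (lam / (Real.pi * s)) *
            Real.exp (2 * lam * mu - lam * s - lam * mu ^ 2 / s))
        ≤ C * (1 + mu ^ ((1 : ℤ) - 2 * k)) := by
  have hpi := Real.pi_pos
  obtain _ | j := k
  · refine ⟨√(lam / Real.pi) * 2 * √(Real.pi / lam), by positivity, fun mu hmu => ?_⟩
    refine (setIntegral_le_of_le_gaussian (A := √(lam / Real.pi) * 2) hlam hmu
      (fun s hs => by positivity) fun s hs => ?_).trans ?_
    · rw [sqrt_mul_exp_eq lam mu hs]
      calc s ^ (-((0 : ℕ) : ℤ)) * (√(lam / Real.pi) * (1 / √s) *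
            Real.exp (-lam * sqrtSubDivSqrt mu s ^ 2))
          = √(lam / Real.pi) * (1 / √s) * Real.exp (-lam * sqrtSubDivSqrt mu s ^ 2) := by simp
        _ ≤ √(lam / Real.pi) * (2 * sqrtSubDivSqrtDeriv mu s) *
            Real.exp (-lam * sqrtSubDivSqrt mu s ^ 2) := by
          gcongr; exact inv_sqrt_le_sqrtSubDivSqrtDeriv hmu hs
        _ = _ := by ring
    · have : 0 < mu ^ ((1 : ℤ) - 2 * (0 : ℕ)) := by positivity
      exact le_mul_of_one_le_right (by positivity) (by linarith)
  · set K : ℝ := j.factorial * (2 / lam) ^ j * Real.exp lam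
    have hK0 : 0 < K := by positivity
    refine ⟨√(lam / Real.pi) * 2 * K * √(Real.pi / (lam / 2)) * 2 ^ j, by positivity,
      fun mu hmu => ?_⟩
    refine (setIntegral_le_of_le_gaussian
      (A := √(lam / Real.pi) * (2 / mu) * (K * ((1 + mu) / mu ^ 2) ^ j)) (half_pos hlam) hmu
      (fun s hs => by positivity) fun s hs => ?_).trans ?_
    · rw [sqrt_mul_exp_eq lam mu hs]
      have hv := (sqrtSubDivSqrtDeriv_pos hmu hs).le
      calc s ^ (-((j + 1 : ℕ) : ℤ)) * (√(lam / Real.pi) * (1 / √s) *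
            Real.exp (-lam * sqrtSubDivSqrt mu s ^ 2))
          = √(lam / Real.pi) * (s⁻¹ * (1 / √s)) *
            ((s⁻¹) ^ j * Real.exp (-lam * sqrtSubDivSqrt mu s ^ 2)) := by
            rw [zpow_neg, zpow_natCast, pow_succ, mul_inv, inv_pow]; ring
        _ ≤ √(lam / Real.pi) * (2 / mu * sqrtSubDivSqrtDeriv mu s) *
            (K * ((1 + mu) / mu ^ 2) ^ j *
              Real.exp (-(lam / 2) * sqrtSubDivSqrt mu s ^ 2)) := by
          gcongr ?_ * ?_ * ?_
          · exact inv_mul_inv_sqrt_le_sqrtSubDivSqrtDeriv hmu hs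
          · exact inv_pow_mul_exp_le j hlam hmu hs
        _ = _ := by ring
    · calc √(lam / Real.pi) * (2 / mu) * (K * ((1 + mu) / mu ^ 2) ^ j) * √(Real.pi / (lam / 2))
          = √(lam / Real.pi) * 2 * K * √(Real.pi / (lam / 2)) *
            (mu⁻¹ * ((1 + mu) / mu ^ 2) ^ j) := by ring
        _ ≤ √(lam / Real.pi) * 2 * K * √(Real.pi / (lam / 2)) *
            (2 ^ j * (1 + mu ^ ((1 : ℤ) - 2 * (j + 1 : ℕ)))) :=
          mul_le_mul_of_nonneg_left (inv_mul_div_sq_pow_le j hmu) (by positivity)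
        _ = _ := by ring
end

section
/- Let n ∈ ℕ, let L < x be real numbers, let y₀, y₁, …, y_{n+1} be real numbers with y₀ = x, y_{n+1} = L and y_i ≥ L for all i ∈ {0, …, n+1}, and let ρ₁, …, ρ_{n+1} ∈ {0,1}. Define the increments Δ_i := y_i − ρ_i y_{i−1} − (1−ρ_i)(2L − y_{i−1}) for i = 1, …, n+1. Then Σ_{i=1}^{n+1} |Δ_i| ≥ x − L. -/
/-- A possibly-reflected increment ending above the reflection level `L` is at least as large as
the unreflected decrease. -/
theorem sub_le_abs_reflected_increment {L a b r : ℝ} (hb : L ≤ b) (hr : r = 0 ∨ r = 1) :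
    a - b ≤ |b - r * a - (1 - r) * (2 * L - a)| := by
  rcases hr with rfl | rfl
  · exact le_trans (by linarith) (le_abs_self _)
  · exact le_trans (by linarith) (neg_le_abs _)

/-- the total variation of the possibly-reflected chain joining `x`
to `L` while staying above `L` dominates `x - L`. -/
theorem stmt_15
    (n : ℕ) (L x : ℝ) (hLx : L < x)
    (y : ℕ → ℝ) (hy0 : y 0 = x) (hyend : y (n + 1) = L)
    (hyL : ∀ i ≤ n + 1, L ≤ y i)
    (ρ : ℕ → ℝ) (hρ : ∀ i, 1 ≤ i → i ≤ n + 1 → ρ i = 0 ∨ ρ i = 1) :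
    x - L ≤ ∑ i ∈ Finset.Icc 1 (n + 1),
      |y i - ρ i * y (i - 1) - (1 - ρ i) * (2 * L - y (i - 1))| := by
  have key : ∀ m ≤ n + 1, x - y m ≤ ∑ i ∈ Finset.Icc 1 m,
      |y i - ρ i * y (i - 1) - (1 - ρ i) * (2 * L - y (i - 1))| := by
    intro m
    induction m with
    | zero => simp [hy0]
    | succ k ih =>
      intro hk
      rw [Finset.sum_Icc_succ_top (by omega), Nat.add_sub_cancel]
      have h := sub_le_abs_reflected_increment (a := y k) (hyL (k + 1) hk)
        (hρ (k + 1) (by omega) hk)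
      linarith [ih (by omega)]
  simpa only [hyend] using key (n + 1) le_rfl
end

section
/- Let n ∈ ℕ, let L < x be real numbers, let y₀, y₁, …, y_{n+1} be real numbers with y₀ = x, y_{n+1} = L and y_i ≥ L for all i ∈ {0, …, n+1}, and let ρ₁, …, ρ_{n+1} ∈ {0,1}. Define Δ_i := y_i − ρ_i y_{i−1} − (1−ρ_i)(2L − y_{i−1}) for i = 1, …, n+1. Then for every k ≥ 1, Σ_{i=1}^{n+1} Δ_i^{2k} ≥ ((x−L)/(n+1))^{2k}. In particular, for every q > 0, (Σ_{i=1}^{n+1} Δ_i^{2k})^{−q} ≤ (n+1)^{2kq} · (x−L)^{−2kq}. -/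
/-- Some step of a finite sequence descends by at least the average descent. -/
theorem exists_average_le_descent (y : ℕ → ℝ) (n : ℕ) :
    ∃ j ≤ n, (y 0 - y (n + 1)) / (n + 1) ≤ y j - y (j + 1) := by
  have hn : (n : ℝ) + 1 ≠ 0 := by positivity
  obtain ⟨j, hj, hle⟩ := Finset.exists_le_of_sum_le
    (s := Finset.range (n + 1)) (f := fun _ => (y 0 - y (n + 1)) / (n + 1))
    (g := fun j => y j - y (j + 1)) (by simp) (by
      rw [Finset.sum_range_sub', Finset.sum_const, Finset.card_range, nsmul_eq_mul]
      push_cast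
      rw [mul_div_cancel₀ _ hn])
  exact ⟨j, by simpa [Nat.lt_succ_iff] using hj, hle⟩

/-- quantitative lower bound for the generalized Malliavin variance
of the reflected chain, and the resulting inverse moment bound. -/
theorem stmt_16
    (n : ℕ) (L x : ℝ) (hLx : L < x)
    (y : ℕ → ℝ) (hy0 : y 0 = x) (hyend : y (n + 1) = L)
    (hyL : ∀ i ≤ n + 1, L ≤ y i)
    (ρ : ℕ → ℝ) (hρ : ∀ i, 1 ≤ i → i ≤ n + 1 → ρ i = 0 ∨ ρ i = 1)
    (k : ℕ) (hk : 1 ≤ k) :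
    ((x - L) / (n + 1)) ^ (2 * k)
        ≤ (∑ i ∈ Finset.Icc 1 (n + 1),
            (y i - ρ i * y (i - 1) - (1 - ρ i) * (2 * L - y (i - 1))) ^ (2 * k)) ∧
      ∀ q : ℝ, 0 < q →
        (∑ i ∈ Finset.Icc 1 (n + 1),
            (y i - ρ i * y (i - 1) - (1 - ρ i) * (2 * L - y (i - 1))) ^ (2 * k))
              ^ (-q)
          ≤ ((n : ℝ) + 1) ^ ((2 * k : ℝ) * q) * (x - L) ^ (-((2 * k : ℝ) * q)) := by
  have hn : (0 : ℝ) < n + 1 := by positivity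
  have hx : 0 < x - L := sub_pos.mpr hLx
  have hd : 0 < (x - L) / (n + 1) := div_pos hx hn
  set S := ∑ i ∈ Finset.Icc 1 (n + 1),
    (y i - ρ i * y (i - 1) - (1 - ρ i) * (2 * L - y (i - 1))) ^ (2 * k)
  have hlower : ((x - L) / (n + 1)) ^ (2 * k) ≤ S := by
    obtain ⟨j, hj, hle⟩ := exists_average_le_descent y n
    rw [hy0, hyend] at hle
    have habs := hle.trans (sub_le_abs_reflected_increment (hyL (j + 1) (by omega))
      (hρ (j + 1) (by omega) (by omega)))
    calc ((x - L) / (n + 1)) ^ (2 * k)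
        ≤ |y (j + 1) - ρ (j + 1) * y j - (1 - ρ (j + 1)) * (2 * L - y j)| ^ (2 * k) :=
          pow_le_pow_left₀ hd.le habs _
      _ = (y (j + 1) - ρ (j + 1) * y j - (1 - ρ (j + 1)) * (2 * L - y j)) ^ (2 * k) :=
          (even_two_mul k).pow_abs _
      _ ≤ S := Finset.single_le_sum
          (f := fun i => (y i - ρ i * y (i - 1) - (1 - ρ i) * (2 * L - y (i - 1))) ^ (2 * k))
          (fun i _ => (even_two_mul k).pow_nonneg _)
          (Finset.mem_Icc.mpr ⟨by omega, by omega⟩ : j + 1 ∈ Finset.Icc 1 (n + 1))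
  refine ⟨hlower, fun q hq => ?_⟩
  calc S ^ (-q) ≤ (((x - L) / (n + 1)) ^ (2 * k)) ^ (-q) :=
        Real.rpow_le_rpow_of_nonpos (pow_pos hd _) hlower (by linarith)
    _ = ((x - L) / (n + 1)) ^ (-((2 * k : ℝ) * q)) := by
        rw [← Real.rpow_natCast, ← Real.rpow_mul hd.le]
        push_cast
        rw [mul_neg]
    _ = ((n : ℝ) + 1) ^ ((2 * k : ℝ) * q) * (x - L) ^ (-((2 * k : ℝ) * q)) := by
        rw [Real.div_rpow hx.le hn.le, Real.rpow_neg hn.le, div_inv_eq_mul, mul_comm]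
end

section
/- For every k ∈ ℕ and λ > 0 there exists a constant C = C(k,λ) > 0 such that for all μ > 0, ∫₀^∞ | s^{−k}·(λ + 1/(2s) − λμ²/s²) + k·s^{−k−1} | · √(λ/(πs)) · exp(2λμ − λs − λμ²/s) ds ≤ C · (1 + μ² + μ^{−(2k+1)}). -/
open MeasureTheory Set

/-- The density of the `GIG(2λ, 2λμ², 1/2)` distribution on `(0, ∞)`. -/
noncomputable def gigDensity (lam mu s : ℝ) : ℝ :=
  Real.sqrt (lam / (Real.pi * s)) * Real.exp (2 * lam * mu - lam * s - lam * mu ^ 2 / s)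

lemma gigDensity_nonneg (lam mu s : ℝ) : 0 ≤ gigDensity lam mu s := by
  unfold gigDensity; positivity

lemma measurable_gigDensity (lam mu : ℝ) : Measurable (gigDensity lam mu) := by
  unfold gigDensity; fun_prop

lemma gig_exponent_eq (lam mu : ℝ) {s : ℝ} (hs : 0 < s) :
    2 * lam * mu - lam * s - lam * mu ^ 2 / s = -(lam * ((s - mu) ^ 2 / s)) := by
  field_simp; ring

lemma sqrt_div_pi_mul (lam : ℝ) {s : ℝ} (hs : 0 < s) :
    Real.sqrt (lam / (Real.pi * s)) = Real.sqrt (lam / Real.pi) * s ^ (-(1 / 2) : ℝ) := by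
  rw [← div_div, Real.sqrt_div' _ hs.le, Real.rpow_neg hs.le, ← Real.sqrt_eq_rpow, div_eq_mul_inv]

/-- Near `μ` the integrand of the `j`-th inverse moment is at most a Gaussian. -/
lemma inv_pow_mul_gigDensity_le_gaussian {lam mu s : ℝ} (hlam : 0 < lam) (hmu : 0 < mu) (j : ℕ)
    (h₁ : mu / 2 ≤ s) (h₂ : s ≤ 2 * mu) :
    (s ^ j)⁻¹ * gigDensity lam mu s ≤
      (2 / mu) ^ j * Real.sqrt (lam / (Real.pi * (mu / 2))) *
        Real.exp (-(lam / (2 * mu)) * (s - mu) ^ 2) := by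
  have hs : 0 < s := lt_of_lt_of_le (by positivity) h₁
  have hpow : (s ^ j)⁻¹ ≤ (2 / mu) ^ j := by
    rw [← inv_pow, ← inv_div]
    gcongr
  have hexp : 2 * lam * mu - lam * s - lam * mu ^ 2 / s ≤ -(lam / (2 * mu)) * (s - mu) ^ 2 := by
    rw [gig_exponent_eq lam mu hs, neg_mul, neg_le_neg_iff, div_mul_eq_mul_div, mul_div_assoc]
    gcongr
  unfold gigDensity
  rw [mul_assoc ((2 / mu) ^ j)]
  gcongr

/-- A bound for inverse moments from a majorant of the integrand away from `μ`. -/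
lemma inv_moment_le_of_majorant {lam mu : ℝ} (hlam : 0 < lam) (hmu : 0 < mu) (j : ℕ)
    {h : ℝ → ℝ} (hint : IntegrableOn h (Ioi 0)) (hnn : ∀ s > 0, 0 ≤ h s)
    (hle : ∀ s > 0, s ≤ mu / 2 ∨ 2 * mu ≤ s → (s ^ j)⁻¹ * gigDensity lam mu s ≤ h s) :
    IntegrableOn (fun s => (s ^ j)⁻¹ * gigDensity lam mu s) (Ioi 0) ∧
      ∫ s in Ioi 0, (s ^ j)⁻¹ * gigDensity lam mu s ≤ (∫ s in Ioi 0, h s) + 2 * (2 / mu) ^ j := by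
  set b : ℝ := lam / (2 * mu) with hb
  have hbpos : 0 < b := by positivity
  set c : ℝ := (2 / mu) ^ j * Real.sqrt (lam / (Real.pi * (mu / 2))) with hc
  have hcnn : 0 ≤ c := by positivity
  have hgauss : Integrable (fun s : ℝ => c * Real.exp (-b * (s - mu) ^ 2)) :=
    ((integrable_exp_neg_mul_sq hbpos).comp_sub_right mu).const_mul c
  have hgint : ∫ s in Ioi (0 : ℝ), c * Real.exp (-b * (s - mu) ^ 2) ≤ 2 * (2 / mu) ^ j := by
    refine (setIntegral_le_integral hgauss
      (Filter.Eventually.of_forall fun s => by positivity)).trans (le_of_eq ?_)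
    rw [integral_const_mul,
      integral_sub_right_eq_self (fun s : ℝ => Real.exp (-b * s ^ 2)) mu, integral_gaussian,
      hc, mul_assoc, ← Real.sqrt_mul (by positivity)]
    have : lam / (Real.pi * (mu / 2)) * (Real.pi / b) = 2 ^ 2 := by
      rw [hb]; field_simp
    rw [this, Real.sqrt_sq (by norm_num), mul_comm]
  have hbound : ∀ s ∈ Ioi (0 : ℝ), (s ^ j)⁻¹ * gigDensity lam mu s ≤
      h s + c * Real.exp (-b * (s - mu) ^ 2) := by
    intro s hs
    by_cases hout : s ≤ mu / 2 ∨ 2 * mu ≤ s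
    · exact (hle s hs hout).trans (le_add_of_nonneg_right (by positivity))
    · push Not at hout
      exact (inv_pow_mul_gigDensity_le_gaussian hlam hmu j hout.1.le hout.2.le).trans
        (le_add_of_nonneg_left (hnn s hs))
  have hdom := hint.add hgauss.integrableOn
  have hmeas : Measurable fun s => (s ^ j)⁻¹ * gigDensity lam mu s :=
    (measurable_id.pow_const j).inv.mul (measurable_gigDensity lam mu)
  have hI : IntegrableOn (fun s => (s ^ j)⁻¹ * gigDensity lam mu s) (Ioi 0) := by
    refine hdom.mono' hmeas.aestronglyMeasurable
      ((ae_restrict_mem measurableSet_Ioi).mono fun s hs => ?_)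
    have := gigDensity_nonneg lam mu s
    have hs' : 0 < s := hs
    rw [Real.norm_of_nonneg (by positivity)]
    exact hbound s hs
  refine ⟨hI, (setIntegral_mono_on hI hdom measurableSet_Ioi hbound).trans ?_⟩
  simp only [Pi.add_apply]
  rw [integral_add hint hgauss.integrableOn]
  gcongr

/-- The inverse-gamma integral, obtained from the gamma integral by inversion. -/
lemma integral_inverse_gamma {a r : ℝ} (ha : 0 < a) (hr : 0 < r) :
    IntegrableOn (fun s : ℝ => s ^ (-a - 1) * Real.exp (-(r / s))) (Ioi 0) ∧
      ∫ s in Ioi (0 : ℝ), s ^ (-a - 1) * Real.exp (-(r / s)) = (1 / r) ^ a * Real.Gamma a := by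
  have hcongr : EqOn
      (fun x : ℝ => (|(-1 : ℝ)| * x ^ ((-1 : ℝ) - 1)) •
        ((x ^ (-1 : ℝ)) ^ (a - 1) * Real.exp (-(r * x ^ (-1 : ℝ)))))
      (fun s : ℝ => s ^ (-a - 1) * Real.exp (-(r / s))) (Ioi 0) := by
    intro x hx
    have hx : 0 < x := hx
    simp only [abs_neg, abs_one, one_mul, smul_eq_mul]
    rw [← mul_assoc, ← Real.rpow_mul hx.le, ← Real.rpow_add hx, Real.rpow_neg_one, div_eq_mul_inv]
    ring_nf
  have hgamma : IntegrableOn (fun t : ℝ => t ^ (a - 1) * Real.exp (-(r * t))) (Ioi 0) := by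
    simpa using integrableOn_rpow_mul_exp_neg_mul_rpow (p := 1) (s := a - 1) (by linarith)
      one_pos hr
  refine ⟨((integrableOn_Ioi_comp_rpow_iff (fun t : ℝ => t ^ (a - 1) * Real.exp (-(r * t)))
    (p := -1) (by norm_num)).2 hgamma).congr_fun hcongr measurableSet_Ioi, ?_⟩
  rw [← setIntegral_congr_fun measurableSet_Ioi hcongr,
    ← Real.integral_rpow_mul_exp_neg_mul_Ioi ha hr]
  exact integral_comp_rpow_Ioi (fun t : ℝ => t ^ (a - 1) * Real.exp (-(r * t))) (by norm_num)

/-- The total mass is bounded uniformly in `μ`. -/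
lemma gig_mass_le {lam : ℝ} (hlam : 0 < lam) :
    ∃ C > 0, ∀ mu : ℝ, 0 < mu → IntegrableOn (fun s => (s ^ 0)⁻¹ * gigDensity lam mu s) (Ioi 0) ∧
      ∫ s in Ioi 0, (s ^ 0)⁻¹ * gigDensity lam mu s ≤ C := by
  set h : ℝ → ℝ := fun s =>
    Real.sqrt (lam / Real.pi) * (s ^ (-(1 / 2) : ℝ) * Real.exp (-(lam / 4) * s)) with hh
  have hnn : ∀ s > 0, 0 ≤ h s := fun s hs => by
    have : 0 < s := hs
    positivity
  have hint : IntegrableOn h (Ioi 0) := by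
    have := integrableOn_rpow_mul_exp_neg_mul_rpow (p := 1) (s := -(1 / 2)) (b := lam / 4)
      (by norm_num) one_pos (by positivity)
    simp only [Real.rpow_one] at this
    exact this.const_mul _
  have hI : 0 ≤ ∫ s in Ioi 0, h s := setIntegral_nonneg measurableSet_Ioi hnn
  refine ⟨(∫ s in Ioi 0, h s) + 2, by positivity, fun mu hmu => ?_⟩
  have key := inv_moment_le_of_majorant hlam hmu 0 hint hnn (fun s hs hout => ?_)
  · simpa using key
  have hexp : s / 4 ≤ (s - mu) ^ 2 / s := by
    rw [le_div_iff₀ hs]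
    rcases hout with h' | h' <;> nlinarith
  rw [gigDensity, gig_exponent_eq lam mu hs, sqrt_div_pi_mul lam hs, hh, mul_assoc]
  simp only [pow_zero, inv_one, one_mul]
  gcongr
  nlinarith

lemma gig_inv_moment_succ_le {lam : ℝ} (hlam : 0 < lam) (j : ℕ) :
    ∃ C > 0, ∀ mu : ℝ, 0 < mu →
      IntegrableOn (fun s => (s ^ (j + 1))⁻¹ * gigDensity lam mu s) (Ioi 0) ∧
      ∫ s in Ioi 0, (s ^ (j + 1))⁻¹ * gigDensity lam mu s ≤
        C * (mu⁻¹ ^ (j + 1) + mu * mu⁻¹ ^ (2 * (j + 1))) := by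
  set a : ℝ := j + 1 / 2 with ha
  have hapos : 0 < a := by positivity
  set K : ℝ := Real.sqrt (lam / Real.pi) * ((4 / lam) ^ a * Real.Gamma a) with hK
  have hKpos : 0 < K := by
    have := Real.Gamma_pos_of_pos hapos
    have := Real.pi_pos
    positivity
  refine ⟨K + 2 * 2 ^ (j + 1), by positivity, fun mu hmu => ?_⟩
  have hr : 0 < lam * mu ^ 2 / 4 := by positivity
  obtain ⟨hgi, hgv⟩ := integral_inverse_gamma hapos hr
  have key := inv_moment_le_of_majorant hlam hmu (j + 1)
    (hgi.const_mul (Real.sqrt (lam / Real.pi)))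
    (fun s hs => by have : 0 < s := hs; positivity) (fun s hs hout => ?_)
  · refine ⟨key.1, key.2.trans ?_⟩
    rw [integral_const_mul, hgv]
    have hscale : (1 / (lam * mu ^ 2 / 4)) ^ a = (4 / lam) ^ a * (mu * mu⁻¹ ^ (2 * (j + 1))) := by
      have h1 : 1 / (lam * mu ^ 2 / 4) = (4 / lam) * (mu⁻¹) ^ 2 := by field_simp
      rw [h1, Real.mul_rpow (by positivity) (by positivity), ← Real.rpow_natCast_mul (by positivity)]
      congr 1
      have h2 : ((2 : ℕ) : ℝ) * a = ((2 * j + 1 : ℕ) : ℝ) := by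
        rw [ha]; push_cast; ring
      have h3 : mu * mu⁻¹ = 1 := mul_inv_cancel₀ hmu.ne'
      rw [h2, Real.rpow_natCast]
      linear_combination (-mu⁻¹ ^ (2 * j + 1)) * h3
    rw [hscale, div_pow, show (2 : ℝ) ^ (j + 1) / mu ^ (j + 1) = 2 ^ (j + 1) * mu⁻¹ ^ (j + 1) by
      rw [inv_pow, div_eq_mul_inv]]
    have e1 : 0 ≤ K * mu⁻¹ ^ (j + 1) := by positivity
    have e2 : 0 ≤ 2 * 2 ^ (j + 1) * (mu * mu⁻¹ ^ (2 * (j + 1))) := by positivity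
    have e3 : Real.sqrt (lam / Real.pi) *
        ((4 / lam) ^ a * (mu * mu⁻¹ ^ (2 * (j + 1))) * Real.Gamma a) =
        K * (mu * mu⁻¹ ^ (2 * (j + 1))) := by rw [hK]; ring
    rw [e3]
    linarith
  have hexp : mu ^ 2 / 4 ≤ (s - mu) ^ 2 := by
    rcases hout with h' | h' <;> nlinarith
  have hpow : (s ^ (j + 1))⁻¹ * s ^ (-(1 / 2) : ℝ) = s ^ (-a - 1) := by
    rw [← Real.rpow_natCast, ← Real.rpow_neg hs.le, ← Real.rpow_add hs]
    congr 1
    rw [ha]; push_cast; ring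
  rw [gigDensity, gig_exponent_eq lam mu hs, sqrt_div_pi_mul lam hs]
  calc _ = Real.sqrt (lam / Real.pi) *
        (((s ^ (j + 1))⁻¹ * s ^ (-(1 / 2) : ℝ)) * Real.exp (-(lam * ((s - mu) ^ 2 / s)))) := by ring
    _ ≤ _ := by
      rw [hpow]
      have : lam * mu ^ 2 / 4 / s = lam * (mu ^ 2 / 4 / s) := by ring
      rw [this]
      gcongr

/-- Inverse moments of the GIG distribution, with their rate as `μ → 0`. -/
lemma gig_inv_moment_le {lam : ℝ} (hlam : 0 < lam) (j : ℕ) :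
    ∃ C > 0, ∀ mu : ℝ, 0 < mu →
      IntegrableOn (fun s => (s ^ j)⁻¹ * gigDensity lam mu s) (Ioi 0) ∧
      ∫ s in Ioi 0, (s ^ j)⁻¹ * gigDensity lam mu s ≤
        C * (mu⁻¹ ^ j + mu * mu⁻¹ ^ (2 * j)) := by
  cases j with
  | zero =>
    obtain ⟨C, hC, h⟩ := gig_mass_le hlam
    refine ⟨C, hC, fun mu hmu => ⟨(h mu hmu).1, (h mu hmu).2.trans ?_⟩⟩
    simp only [mul_zero, pow_zero, mul_one]
    nlinarith
  | succ j => exact gig_inv_moment_succ_le hlam j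

lemma pow_le_one_add_pow {x : ℝ} (hx : 0 ≤ x) {m n : ℕ} (hmn : m ≤ n) : x ^ m ≤ 1 + x ^ n := by
  rcases le_total x 1 with h | h
  · linarith [pow_le_one₀ hx h (n := m), pow_nonneg hx n]
  · linarith [pow_le_pow_right₀ h hmn]

/-- space degeneration estimate for the dual weight `𝙸(s^{-k})`
integrated against the GIG(2λ, 2λμ², 1/2) density. -/
theorem stmt_18 (k : ℕ) (lam : ℝ) (hlam : 0 < lam) :
    ∃ C > 0, ∀ mu : ℝ, 0 < mu →
      ∫ s in Set.Ioi (0 : ℝ),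
          |s ^ (-(k : ℤ)) * (lam + 1 / (2 * s) - lam * mu ^ 2 / s ^ 2)
              + (k : ℝ) * s ^ (-(k : ℤ) - 1)| *
            (Real.sqrt (lam / (Real.pi * s)) *
              Real.exp (2 * lam * mu - lam * s - lam * mu ^ 2 / s))
        ≤ C * (1 + mu ^ 2 + mu ^ (-(2 * (k : ℤ) + 1))) := by
  obtain ⟨A, hA, hA'⟩ := gig_inv_moment_le hlam k
  obtain ⟨B, hB, hB'⟩ := gig_inv_moment_le hlam (k + 1)
  obtain ⟨D, hD, hD'⟩ := gig_inv_moment_le hlam (k + 2)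
  refine ⟨lam * A * 2 + (1 / 2 + k) * B * 2 + lam * D * 2, by positivity, fun mu hmu => ?_⟩
  obtain ⟨iA, bA⟩ := hA' mu hmu
  obtain ⟨iB, bB⟩ := hB' mu hmu
  obtain ⟨iD, bD⟩ := hD' mu hmu
  have hmaj := ((iA.const_mul lam).add (iB.const_mul (1 / 2 + (k : ℝ)))).add
    (iD.const_mul (lam * mu ^ 2))
  have hle := integral_mono_of_nonneg (μ := volume.restrict (Ioi (0 : ℝ)))
    (f := fun s => |s ^ (-(k : ℤ)) * (lam + 1 / (2 * s) - lam * mu ^ 2 / s ^ 2)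
      + (k : ℝ) * s ^ (-(k : ℤ) - 1)| * (Real.sqrt (lam / (Real.pi * s)) *
        Real.exp (2 * lam * mu - lam * s - lam * mu ^ 2 / s)))
    (Filter.Eventually.of_forall fun s => by dsimp only [Pi.zero_apply]; positivity) hmaj
    ((ae_restrict_mem measurableSet_Ioi).mono fun s hs => ?_)
  · refine hle.trans ?_
    simp only [Pi.add_apply]
    rw [integral_add (by exact (iA.const_mul lam).add (iB.const_mul (1 / 2 + (k : ℝ))))
        (iD.const_mul _),
      integral_add (iA.const_mul _) (iB.const_mul _), integral_const_mul, integral_const_mul,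
      integral_const_mul]
    have hz : mu ^ (-(2 * (k : ℤ) + 1)) = mu⁻¹ ^ (2 * k + 1) := by
      rw [zpow_neg, inv_pow, ← zpow_natCast]
      push_cast
      rfl
    rw [hz]
    set x := mu⁻¹ with hx
    have hxpos : 0 < x := by positivity
    have hmx : mu * x = 1 := mul_inv_cancel₀ hmu.ne'
    have p0 : x ^ k ≤ 1 + x ^ (2 * k + 1) := pow_le_one_add_pow hxpos.le (by omega)
    have p1 : x ^ (k + 1) ≤ 1 + x ^ (2 * k + 1) := pow_le_one_add_pow hxpos.le (by omega)
    have q0 : mu * x ^ (2 * k) ≤ 1 + mu ^ 2 + x ^ (2 * k + 1) := by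
      have hp : 0 ≤ x ^ (2 * k + 1) := by positivity
      have : mu * x ^ (2 * k) = mu ^ 2 * x ^ (2 * k + 1) := by
        linear_combination (-mu * x ^ (2 * k)) * hmx
      rcases le_total mu 1 with h | h
      · rw [this]
        nlinarith [sq_nonneg mu, mul_le_mul_of_nonneg_right (pow_le_one₀ hmu.le h (n := 2)) hp]
      · have hx1 : x ≤ 1 := inv_le_one_of_one_le₀ h
        have := mul_le_mul_of_nonneg_left (pow_le_one₀ hxpos.le hx1 (n := 2 * k)) hmu.le
        nlinarith
    have q1 : mu * x ^ (2 * (k + 1)) = x ^ (2 * k + 1) := by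
      linear_combination x ^ (2 * k + 1) * hmx
    have r0 : mu ^ 2 * x ^ (k + 2) = x ^ k := by
      linear_combination x ^ k * (mu * x + 1) * hmx
    have r1 : mu ^ 2 * (mu * x ^ (2 * (k + 2))) = x ^ (2 * k + 1) := by
      linear_combination x ^ (2 * k + 1) * (mu ^ 2 * x ^ 2 + mu * x + 1) * hmx
    set R := 1 + mu ^ 2 + x ^ (2 * k + 1) with hR
    have hmu2 : 0 ≤ mu ^ 2 := sq_nonneg mu
    have hX : 0 ≤ x ^ (2 * k + 1) := by positivity
    calc _ ≤ lam * (A * (x ^ k + mu * x ^ (2 * k)))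
          + (1 / 2 + k) * (B * (x ^ (k + 1) + mu * x ^ (2 * (k + 1))))
          + lam * mu ^ 2 * (D * (x ^ (k + 2) + mu * x ^ (2 * (k + 2)))) := by gcongr
      _ = lam * A * (x ^ k + mu * x ^ (2 * k))
          + (1 / 2 + k) * B * (x ^ (k + 1) + x ^ (2 * k + 1))
          + lam * D * (x ^ k + x ^ (2 * k + 1)) := by
        rw [q1]
        linear_combination lam * D * r0 + lam * D * r1
      _ ≤ lam * A * (2 * R) + (1 / 2 + k) * B * (2 * R) + lam * D * (2 * R) := by
        gcongr <;> linarith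
      _ = _ := by ring
  · have hs : 0 < s := hs
    have hq := gigDensity_nonneg lam mu s
    have hz : s ^ (-(k : ℤ)) = (s ^ k)⁻¹ := by rw [zpow_neg, zpow_natCast]
    have hz1 : s ^ (-(k : ℤ) - 1) = (s ^ (k + 1))⁻¹ := by
      rw [zpow_sub_one₀ hs.ne', hz, pow_succ, mul_inv]
    change _ * gigDensity lam mu s ≤ _
    rw [hz, hz1]
    have habs : |(s ^ k)⁻¹ * (lam + 1 / (2 * s) - lam * mu ^ 2 / s ^ 2)
        + (k : ℝ) * (s ^ (k + 1))⁻¹| ≤ lam * (s ^ k)⁻¹ + (1 / 2 + k) * (s ^ (k + 1))⁻¹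
          + lam * mu ^ 2 * (s ^ (k + 2))⁻¹ := by
      have e : (s ^ k)⁻¹ * (lam + 1 / (2 * s) - lam * mu ^ 2 / s ^ 2)
          + (k : ℝ) * (s ^ (k + 1))⁻¹ = (lam * (s ^ k)⁻¹ + (1 / 2 + k) * (s ^ (k + 1))⁻¹)
          - lam * mu ^ 2 * (s ^ (k + 2))⁻¹ := by
        field_simp
        ring
      have n1 : 0 ≤ lam * (s ^ k)⁻¹ + (1 / 2 + k) * (s ^ (k + 1))⁻¹ := by positivity
      have n2 : 0 ≤ lam * mu ^ 2 * (s ^ (k + 2))⁻¹ := by positivity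
      rw [e, abs_le]
      constructor <;> linarith
    refine (mul_le_mul_of_nonneg_right habs hq).trans (le_of_eq ?_)
    simp only [Pi.add_apply]
    ring
end

section
/- Let a : ℝ → ℝ be bounded and continuously differentiable with bounded derivative (hence Lipschitz with constant K := sup|a'|). Let L ≤ x, ρ ∈ {0,1}, μ₀ := ρx + (1−ρ)(2L−x), and p ≥ 1. There exists a constant C = C(sup|a|, K, p) > 0, independent of the variance, such that for every v > 0, if X = μ₀ + Z with Z a centered Gaussian of variance v, then E[ 1_{X ≥ L} · | (a(X) − a(x))·(X − μ₀)/v − a'(X) |^p ] ≤ C. -/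
open MeasureTheory ProbabilityTheory

/-- The standardization of a real Gaussian random variable is standard Gaussian. -/
theorem gaussianReal_map_standardize (m : ℝ) {v : ℝ} (hv : 0 < v) :
    (gaussianReal m (Real.toNNReal v)).map (fun y => (y - m) / √v) = gaussianReal 0 1 := by
  have hcomp : (fun y : ℝ => (y - m) / √v) = (fun z => z / √v) ∘ (fun y => y - m) := rfl
  rw [hcomp, ← Measure.map_map (by fun_prop) (by fun_prop), gaussianReal_map_sub_const,
    gaussianReal_map_div_const]
  congr 1
  · simp
  · ext
    simp [Real.sq_sqrt hv.le, hv.le, hv.ne']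

theorem integrable_one_add_abs_rpow_gaussianReal {q : ℝ} (hq : 0 < q) :
    Integrable (fun s : ℝ => (1 + |s|) ^ q) (gaussianReal 0 1) := by
  have hid : MemLp (id : ℝ → ℝ) (ENNReal.ofReal q) (gaussianReal 0 1) :=
    memLp_id_gaussianReal' _ ENNReal.ofReal_ne_top
  have hsum : MemLp (fun s : ℝ => 1 + |s|) (ENNReal.ofReal q) (gaussianReal 0 1) :=
    (memLp_const (1 : ℝ)).add hid.norm
  refine (hsum.integrable_norm_rpow (by simpa using hq) ENNReal.ofReal_ne_top).congr
    (Filter.Eventually.of_forall fun s => ?_)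
  simp only [Real.norm_eq_abs, ENNReal.toReal_ofReal hq.le]
  rw [abs_of_nonneg (by positivity : 0 ≤ 1 + |s|)]

/-- Beyond `L`, the distance to `x ≥ L` is at most the distance to `x` or to its reflection
in `L`. -/
theorem abs_sub_le_abs_sub_reflection {L x y ρ : ℝ} (hx : L ≤ x) (hy : L ≤ y)
    (hρ : ρ = 0 ∨ ρ = 1) :
    |y - x| ≤ |y - (ρ * x + (1 - ρ) * (2 * L - x))| := by
  rcases hρ with rfl | rfl
  · refine le_trans ?_ (le_abs_self _)
    rw [abs_le]
    constructor <;> linarith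
  · simp

theorem abs_weight_rpow_le {a : ℝ → ℝ} {K p x y m v : ℝ} (hp : 0 ≤ p) (ha : ContDiff ℝ 1 a)
    (hK : ∀ y, |deriv a y| ≤ K) (hv : 0 < v) (hxy : |y - x| ≤ |y - m|) :
    |(a y - a x) * (y - m) / v - deriv a y| ^ p
      ≤ K ^ p * (1 + |(y - m) / √v|) ^ (2 * p) := by
  have hK0 : 0 ≤ K := (abs_nonneg _).trans (hK 0)
  have hlip : |a y - a x| ≤ K * |y - x| := by
    simpa using convex_univ.norm_image_sub_le_of_norm_deriv_le
      (fun z _ => (ha.differentiable one_ne_zero) z) (fun z _ => hK z)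
      (Set.mem_univ x) (Set.mem_univ y)
  have hsq : |(y - m) / √v| ^ 2 = |y - m| * |y - m| / v := by
    rw [sq_abs, div_pow, Real.sq_sqrt hv.le, abs_mul_abs_self, sq]
  have hquot : |(a y - a x) * (y - m) / v| ≤ K * |(y - m) / √v| ^ 2 := by
    rw [hsq, abs_div, abs_mul, abs_of_pos hv, ← mul_div_assoc, ← mul_assoc]
    have := hlip.trans (mul_le_mul_of_nonneg_left hxy hK0)
    gcongr
  have hbound : |(a y - a x) * (y - m) / v - deriv a y| ≤ K * (1 + |(y - m) / √v|) ^ 2 := by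
    have hnn := mul_nonneg hK0 (abs_nonneg ((y - m) / √v))
    calc _ ≤ |(a y - a x) * (y - m) / v| + |deriv a y| := abs_sub _ _
      _ ≤ K * |(y - m) / √v| ^ 2 + K := add_le_add hquot (hK y)
      _ ≤ _ := by nlinarith
  calc _ ≤ (K * (1 + |(y - m) / √v|) ^ 2) ^ p :=
        Real.rpow_le_rpow (abs_nonneg _) hbound hp
    _ = _ := by
        rw [Real.mul_rpow hK0 (by positivity), Real.rpow_mul (by positivity), Real.rpow_two]

/-- uniform-in-variance `L^p` bound for the Malliavin weight
`I(a(·) - a(x))(X) = (a(X) - a(x))(X - μ₀)/v - a'(X)` on the event `{X ≥ L}`,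
where `X` is Gaussian with mean `μ₀ = ρx + (1-ρ)(2L-x)` and variance `v`. The
constant depends only on the bound for `|a|`, the Lipschitz constant `K` and `p`. -/
theorem stmt_19 (Ca K p : ℝ) (hp : 1 ≤ p) :
    ∃ C > 0, ∀ a : ℝ → ℝ, ContDiff ℝ 1 a →
      (∀ y, |a y| ≤ Ca) → (∀ y, |deriv a y| ≤ K) →
      ∀ L x ρ : ℝ, L ≤ x → (ρ = 0 ∨ ρ = 1) →
      ∀ v : ℝ, 0 < v →
        ∫ y in Set.Ici L,
            |(a y - a x) * (y - (ρ * x + (1 - ρ) * (2 * L - x))) / v - deriv a y| ^ p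
          ∂(gaussianReal (ρ * x + (1 - ρ) * (2 * L - x)) (Real.toNNReal v))
        ≤ C := by
  set M : ℝ := ∫ s : ℝ, (1 + |s|) ^ (2 * p) ∂(gaussianReal 0 1)
  have hM : 0 ≤ M := integral_nonneg fun s => by positivity
  refine ⟨|K| ^ p * M + 1, by positivity, ?_⟩
  intro a ha _ hK L x ρ hx hρ v hv
  set m := ρ * x + (1 - ρ) * (2 * L - x)
  have hK0 : 0 ≤ K := (abs_nonneg _).trans (hK 0)
  have hstd : MeasurePreserving (fun y => (y - m) / √v)
      (gaussianReal m (Real.toNNReal v)) (gaussianReal 0 1) :=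
    ⟨by fun_prop, gaussianReal_map_standardize m hv⟩
  have hint0 := integrable_one_add_abs_rpow_gaussianReal (q := 2 * p) (by linarith)
  have hint : Integrable (fun y => K ^ p * (1 + |(y - m) / √v|) ^ (2 * p))
      (gaussianReal m (Real.toNNReal v)) :=
    (hstd.integrable_comp_of_integrable hint0).const_mul _
  have hval : ∫ y, (1 + |(y - m) / √v|) ^ (2 * p) ∂(gaussianReal m (Real.toNNReal v)) = M := by
    have := integral_map (μ := gaussianReal m (Real.toNNReal v)) hstd.measurable.aemeasurable
      (f := fun s : ℝ => (1 + |s|) ^ (2 * p)) (by rw [hstd.map_eq]; exact hint0.1)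
    rw [← this, hstd.map_eq]
  calc _ ≤ ∫ y in Set.Ici L, K ^ p * (1 + |(y - m) / √v|) ^ (2 * p)
          ∂(gaussianReal m (Real.toNNReal v)) := by
        refine integral_mono_of_nonneg (Filter.Eventually.of_forall fun y => by positivity)
          hint.integrableOn ?_
        filter_upwards [ae_restrict_mem measurableSet_Ici] with y hy
        exact abs_weight_rpow_le (by linarith) ha hK hv (abs_sub_le_abs_sub_reflection hx hy hρ)
    _ ≤ ∫ y, K ^ p * (1 + |(y - m) / √v|) ^ (2 * p) ∂(gaussianReal m (Real.toNNReal v)) :=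
        setIntegral_le_integral hint (Filter.Eventually.of_forall fun y => by positivity)
    _ = |K| ^ p * M := by rw [integral_const_mul, hval, abs_of_nonneg hK0]
    _ ≤ _ := by linarith
end
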